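/- arXiv:1808.04466 — 3 statements merged into one kernel-verified Lean document; each statement's English description precedes it below -/
import Mathlib

section
/- Let E be a directed graph with E⁰ finite and K a field, and let L = L_K(E) be the (unital) Leavitt path algebra. Then L is hereditary: every left ideal of L is projective as a left L-module. -/
/-- Generators for the Leavitt path algebra of a directed graph: one generator for each
vertex `v`, each edge `e`, and each ghost edge `e*`. -/
inductive LPAGen (V E : Type) : Type
  | vertex : V → LPAGen V E
  | edge : E → LPAGen V E
  | ghost : E → LPAGen V E

/-- The defining relations of the (unital) Leavitt path algebra of a directed graph
`(V, E, s, r)` with finitely many vertices, imposed on the free unital `K`-algebra on the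
generators; the relation `unit` makes the identity equal to the sum of the vertices. -/
inductive LPARel (K : Type) [Field K] (V E : Type) [Fintype V] (s r : E → V) :
    FreeAlgebra K (LPAGen V E) → FreeAlgebra K (LPAGen V E) → Prop
  | vertex_orth (v w : V) (h : v ≠ w) :
      LPARel K V E s r (FreeAlgebra.ι K (LPAGen.vertex v) * FreeAlgebra.ι K (LPAGen.vertex w)) 0
  | vertex_idem (v : V) :
      LPARel K V E s r (FreeAlgebra.ι K (LPAGen.vertex v) * FreeAlgebra.ι K (LPAGen.vertex v))
        (FreeAlgebra.ι K (LPAGen.vertex v))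
  | edge_src (e : E) :
      LPARel K V E s r (FreeAlgebra.ι K (LPAGen.vertex (s e)) * FreeAlgebra.ι K (LPAGen.edge e))
        (FreeAlgebra.ι K (LPAGen.edge e))
  | edge_rng (e : E) :
      LPARel K V E s r (FreeAlgebra.ι K (LPAGen.edge e) * FreeAlgebra.ι K (LPAGen.vertex (r e)))
        (FreeAlgebra.ι K (LPAGen.edge e))
  | ghost_rng (e : E) :
      LPARel K V E s r (FreeAlgebra.ι K (LPAGen.vertex (r e)) * FreeAlgebra.ι K (LPAGen.ghost e))
        (FreeAlgebra.ι K (LPAGen.ghost e))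
  | ghost_src (e : E) :
      LPARel K V E s r (FreeAlgebra.ι K (LPAGen.ghost e) * FreeAlgebra.ι K (LPAGen.vertex (s e)))
        (FreeAlgebra.ι K (LPAGen.ghost e))
  | ck1_distinct (e f : E) (h : e ≠ f) :
      LPARel K V E s r (FreeAlgebra.ι K (LPAGen.ghost e) * FreeAlgebra.ι K (LPAGen.edge f)) 0
  | ck1_same (e : E) :
      LPARel K V E s r (FreeAlgebra.ι K (LPAGen.ghost e) * FreeAlgebra.ι K (LPAGen.edge e))
        (FreeAlgebra.ι K (LPAGen.vertex (r e)))
  | ck2 (v : V) (h : {e : E | s e = v}.Finite) (hne : {e : E | s e = v}.Nonempty) :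
      LPARel K V E s r (FreeAlgebra.ι K (LPAGen.vertex v))
        (∑ e ∈ h.toFinset, FreeAlgebra.ι K (LPAGen.edge e) * FreeAlgebra.ι K (LPAGen.ghost e))
  | unit :
      LPARel K V E s r 1 (∑ v : V, FreeAlgebra.ι K (LPAGen.vertex v))

/-- The unital Leavitt path algebra `L_K(E)` of a directed graph with finitely many
vertices, as the quotient of the free unital `K`-algebra on the generators by the
defining relations. -/
abbrev LeavittPathAlgebra (K : Type) [Field K] (V E : Type) [Fintype V] (s r : E → V) :=
  RingQuot (LPARel K V E s r)



namespace LPAHered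

open LPAGen

/-- A family of elements of a ring satisfying the Leavitt path algebra relations. -/
structure LRel {V E : Type} [Fintype V] (s r : E → V) {A : Type*} [Ring A]
    (a : LPAGen V E → A) : Prop where
  vorth : ∀ v w, v ≠ w → a (vertex v) * a (vertex w) = 0
  videm : ∀ v, a (vertex v) * a (vertex v) = a (vertex v)
  esrc : ∀ e, a (vertex (s e)) * a (edge e) = a (edge e)
  erng : ∀ e, a (edge e) * a (vertex (r e)) = a (edge e)
  grng : ∀ e, a (vertex (r e)) * a (ghost e) = a (ghost e)
  gsrc : ∀ e, a (ghost e) * a (vertex (s e)) = a (ghost e)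
  ck1d : ∀ e f, e ≠ f → a (ghost e) * a (edge f) = 0
  ck1s : ∀ e, a (ghost e) * a (edge e) = a (vertex (r e))
  ck2 : ∀ v (h : {e : E | s e = v}.Finite), {e : E | s e = v}.Nonempty →
    a (vertex v) = ∑ e ∈ h.toFinset, a (edge e) * a (ghost e)
  unit : 1 = ∑ v : V, a (vertex v)

variable {K V E : Type} [Field K] [Fintype V] {s r : E → V}

/-- The image of a generator in the Leavitt path algebra. -/
noncomputable def gen (K : Type) [Field K] {V E : Type} [Fintype V] (s r : E → V)
    (g : LPAGen V E) : LeavittPathAlgebra K V E s r :=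
  RingQuot.mkAlgHom K (LPARel K V E s r) (FreeAlgebra.ι K g)

theorem gen_rel : LRel s r (gen K s r) := by
  have key : ∀ {x y}, LPARel K V E s r x y → RingQuot.mkAlgHom K (LPARel K V E s r) x
      = RingQuot.mkAlgHom K (LPARel K V E s r) y := fun h => RingQuot.mkAlgHom_rel K h
  constructor
  · intro v w h; simpa [gen] using key (.vertex_orth v w h)
  · intro v; simpa [gen] using key (.vertex_idem v)
  · intro v; simpa [gen] using key (.edge_src v)
  · intro v; simpa [gen] using key (.edge_rng v)
  · intro v; simpa [gen] using key (.ghost_rng v)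
  · intro v; simpa [gen] using key (.ghost_src v)
  · intro v w h; simpa [gen] using key (.ck1_distinct v w h)
  · intro v; simpa [gen] using key (.ck1_same v)
  · intro v h hne; simpa [gen] using key (.ck2 v h hne)
  · simpa [gen] using key (.unit)

theorem exists_lift {A : Type} [Ring A] [Algebra K A] {a : LPAGen V E → A} (ha : LRel s r a) :
    ∃ ρ : LeavittPathAlgebra K V E s r →ₐ[K] A, ∀ g, ρ (gen K s r g) = a g := by
  refine ⟨RingQuot.liftAlgHom K ⟨FreeAlgebra.lift K a, ?_⟩, ?_⟩
  · intro x y h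
    induction h with
    | vertex_orth v w h => simpa using ha.vorth v w h
    | vertex_idem v => simpa using ha.videm v
    | edge_src e => simpa using ha.esrc e
    | edge_rng e => simpa using ha.erng e
    | ghost_rng e => simpa using ha.grng e
    | ghost_src e => simpa using ha.gsrc e
    | ck1_distinct e f h => simpa using ha.ck1d e f h
    | ck1_same e => simpa using ha.ck1s e
    | ck2 v h hne => simpa using ha.ck2 v h hne
    | unit => simpa using ha.unit
  · intro g
    simp [gen]

theorem gen_induction {C : LeavittPathAlgebra K V E s r → Prop}
    (h0 : ∀ k : K, C (algebraMap K _ k)) (h1 : ∀ g, C (gen K s r g))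
    (hm : ∀ x y, C x → C y → C (x * y)) (ha : ∀ x y, C x → C y → C (x + y)) (x) : C x := by
  obtain ⟨y, rfl⟩ := RingQuot.mkAlgHom_surjective K (LPARel K V E s r) x
  induction y using FreeAlgebra.induction with
  | grade0 k => simpa using h0 k
  | grade1 g => exact h1 g
  | mul a b iha ihb => rw [map_mul]; exact hm _ _ iha ihb
  | add a b iha ihb => rw [map_add]; exact ha _ _ iha ihb

section lin

theorem exists_quasi {A B : Type*} [AddCommGroup A] [AddCommGroup B] [Module K A] [Module K B]
    (β : A →ₗ[K] B) : ∃ γ : B →ₗ[K] A, ∀ x, β (γ (β x)) = β x := by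
  obtain ⟨c, hc⟩ := β.rangeRestrict.exists_rightInverse_of_surjective β.range_rangeRestrict
  obtain ⟨γ, hγ⟩ := c.exists_extend
  refine ⟨γ, fun x => ?_⟩
  have h1 : γ (β x) = c (β.rangeRestrict x) := LinearMap.congr_fun hγ (β.rangeRestrict x)
  have h2 := congrArg Subtype.val (LinearMap.congr_fun hc (β.rangeRestrict x))
  rw [h1]; simpa using h2

theorem exists_ext {A M N T : Type*} [AddCommGroup A] [AddCommGroup M] [AddCommGroup N]
    [AddCommGroup T] [Module K A] [Module K M] [Module K N] [Module K T]
    (β : A →ₗ[K] M) (h : A →ₗ[K] N) (p : N →ₗ[K] T) (δ : M →ₗ[K] T)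
    (hδ : ∀ m, ∃ n, p n = δ m) (hk : ∀ x, β x = 0 → h x = 0) (hp : ∀ x, p (h x) = δ (β x)) :
    ∃ g : M →ₗ[K] N, (∀ x, g (β x) = h x) ∧ ∀ m, p (g m) = δ m := by
  obtain ⟨γ, hγ⟩ := exists_quasi β
  obtain ⟨t, ht⟩ := exists_quasi p
  have h1 : ∀ x, h (γ (β x)) = h x := fun x => by
    have := hk (γ (β x) - x) (by rw [map_sub, hγ, sub_self])
    rwa [map_sub, sub_eq_zero] at this
  refine ⟨h ∘ₗ γ + t ∘ₗ (δ - p ∘ₗ h ∘ₗ γ), fun x => ?_, fun m => ?_⟩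
  · simp [h1, hp]
  · obtain ⟨n, hn⟩ := hδ m
    have := ht (n - h (γ m))
    rw [map_sub, hn] at this
    simp only [LinearMap.add_apply, LinearMap.comp_apply, LinearMap.sub_apply, map_add, this]
    abel

end lin

section main

variable {L : Type} [Ring L] [Algebra K L] {a : LPAGen V E → L}

theorem exists_quasi_vertex (ha : LRel s r a) {A B : Type} [AddCommGroup A] [AddCommGroup B]
    [Module K A] [Module K B] [Module L A] [Module L B] [IsScalarTower K L A]
    [IsScalarTower K L B] (β : A →ₗ[L] B) :
    ∃ γ : B →ₗ[K] A, (∀ x, β (γ (β x)) = β x) ∧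
      ∀ v b, γ (a (vertex v) • b) = a (vertex v) • γ b := by
  classical
  obtain ⟨γ, hγ⟩ := exists_quasi (β.restrictScalars K)
  simp only [LinearMap.coe_restrictScalars] at hγ
  refine ⟨∑ v : V, Algebra.lsmul K K A (a (vertex v)) ∘ₗ γ ∘ₗ Algebra.lsmul K K B (a (vertex v)),
    fun x => ?_, fun v b => ?_⟩
  · simp only [LinearMap.sum_apply, LinearMap.comp_apply, Algebra.lsmul_coe, map_sum, map_smul]
    have : ∀ v, a (vertex v) • β (γ (a (vertex v) • β x)) = a (vertex v) • β x := fun v => by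
      rw [← map_smul β _ x, hγ, map_smul, ← mul_smul, ha.videm]
    rw [Finset.sum_congr rfl fun v _ => this v, ← Finset.sum_smul, ← ha.unit, one_smul]
  · simp only [LinearMap.sum_apply, LinearMap.comp_apply, Algebra.lsmul_coe, Finset.smul_sum,
      ← mul_smul]
    rw [Finset.sum_eq_single v, Finset.sum_eq_single v]
    · rw [ha.videm]
    · intro w _ hw; rw [ha.vorth _ _ hw.symm, zero_smul]
    · simp
    · intro w _ hw; rw [ha.vorth _ _ hw, zero_smul, map_zero, smul_zero]
    · simp

theorem exists_action (ha : LRel s r a) {N M T : Type} [AddCommGroup N] [AddCommGroup M]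
    [AddCommGroup T] [Module K N] [Module K M] [Module K T] [Module L N] [Module L M] [Module L T]
    [IsScalarTower K L N] [IsScalarTower K L M] [IsScalarTower K L T]
    (p : N →ₗ[L] T) (q : T →ₗ[L] M) (hq : Function.Surjective q)
    (hpq : ∀ t, q t = 0 ↔ ∃ n, p n = t) :
    ∃ (σ : M →ₗ[K] T) (b : LPAGen V E → Module.End K (N × M)), (∀ m, q (σ m) = m) ∧
      LRel s r b ∧ (∀ g n, b g (n, 0) = (a g • n, 0)) ∧
      ∀ g n m, p (b g (n, m)).1 + σ (b g (n, m)).2 = a g • (p n + σ m) := by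
  classical
  obtain ⟨σ, hσ0, hσv⟩ := exists_quasi_vertex (K := K) ha q
  have hσ : ∀ m, q (σ m) = m := fun m => by obtain ⟨t, rfl⟩ := hq m; exact hσ0 t
  obtain ⟨t, ht, htv⟩ := exists_quasi_vertex (K := K) ha p
  -- the defect of `σ`
  let δ : LPAGen V E → M →ₗ[K] T := fun g =>
    Algebra.lsmul K K T (a g) ∘ₗ σ - σ ∘ₗ Algebra.lsmul K K M (a g)
  have δa : ∀ g m, δ g m = a g • σ m - σ (a g • m) := fun g m => rfl
  have δr : ∀ g m, ∃ n, p n = δ g m := fun g m => by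
    rw [← hpq, δa, map_sub, map_smul, hσ, hσ, sub_self]
  have esv : ∀ {X : Type} [AddCommGroup X] [Module L X] (e : E) (x : X),
      a (vertex (s e)) • a (edge e) • x = a (edge e) • x := fun e x => by rw [← mul_smul, ha.esrc]
  have erv : ∀ {X : Type} [AddCommGroup X] [Module L X] (e : E) (x : X),
      a (edge e) • a (vertex (r e)) • x = a (edge e) • x := fun e x => by rw [← mul_smul, ha.erng]
  have gsv : ∀ {X : Type} [AddCommGroup X] [Module L X] (e : E) (x : X),
      a (ghost e) • a (vertex (s e)) • x = a (ghost e) • x := fun e x => by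
    rw [← mul_smul, ha.gsrc]
  have grv : ∀ {X : Type} [AddCommGroup X] [Module L X] (e : E) (x : X),
      a (vertex (r e)) • a (ghost e) • x = a (ghost e) • x := fun e x => by
    rw [← mul_smul, ha.grng]
  let D : E → M →ₗ[K] N := fun e => t ∘ₗ δ (edge e)
  have pD : ∀ e m, p (D e m) = δ (edge e) m := fun e m => by
    obtain ⟨n, hn⟩ := δr (edge e) m
    change p (t (δ (edge e) m)) = _
    rw [← hn, ht]
  have Ds : ∀ e m, a (vertex (s e)) • D e m = D e m := fun e m => by
    change a (vertex (s e)) • t (δ (edge e) m) = t (δ (edge e) m)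
    rw [← htv, δa, smul_sub, esv, ← hσv, esv]
  have Dr : ∀ e m, D e (a (vertex (r e)) • m) = D e m := fun e m => by
    change t (δ (edge e) _) = t (δ (edge e) m)
    rw [δa, δa, hσv, erv, erv]
  -- the ghost edges
  have hG : ∀ e, ∃ G : M →ₗ[K] N, (∀ m, p (G m) = δ (ghost e) m) ∧
      (∀ m, a (vertex (r e)) • G m = G m) ∧ (∀ m, G (a (vertex (s e)) • m) = G m) ∧
      ∀ f m, G (a (edge f) • m) = - (a (ghost e) • D f m) := by
    intro e
    let β : (E →₀ M) →ₗ[K] M := Finsupp.lsum K fun f => Algebra.lsmul K K M (a (edge f))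
    let h : (E →₀ M) →ₗ[K] N := Finsupp.lsum K fun f =>
      - (Algebra.lsmul K K N (a (ghost e)) ∘ₗ D f)
    have βa : ∀ x : E →₀ M, β x = ∑ f ∈ x.support, a (edge f) • x f := fun x => rfl
    have hha : ∀ x : E →₀ M, h x = ∑ f ∈ x.support, -(a (ghost e) • D f (x f)) := fun x => rfl
    have βs : ∀ f m, β (Finsupp.single f m) = a (edge f) • m := fun f m => by simp [β]
    have hs : ∀ f m, h (Finsupp.single f m) = -(a (ghost e) • D f m) := fun f m => by simp [h]
    have gβ : ∀ f x, a (ghost f) • β x = a (vertex (r f)) • x f := fun f x => by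
      rw [βa, Finset.smul_sum, Finset.sum_eq_single f]
      · rw [← mul_smul, ha.ck1s]
      · intro g _ hg; rw [← mul_smul, ha.ck1d _ _ hg.symm, zero_smul]
      · intro hf; rw [Finsupp.notMem_support_iff.1 hf]; simp
    obtain ⟨g, hg1, hg2⟩ := exists_ext β h (p.restrictScalars K) (δ (ghost e)) (δr (ghost e))
      (fun x hx => by
        rw [hha]
        refine Finset.sum_eq_zero fun f _ => ?_
        rw [← Dr, ← gβ, hx]; simp)
      (fun x => by
        have : (p.restrictScalars K) ∘ₗ h = δ (ghost e) ∘ₗ β := by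
          refine Finsupp.lhom_ext fun f m => ?_
          simp only [LinearMap.comp_apply, hs, βs, LinearMap.coe_restrictScalars, map_neg,
            map_smul, pD, δa, smul_sub]
          by_cases hef : e = f
          · subst hef
            simp only [← mul_smul, ha.ck1s, hσv]
            simp
          · simp only [← mul_smul, ha.ck1d _ _ hef]
            simp
        exact LinearMap.congr_fun this x)
    simp only [LinearMap.coe_restrictScalars] at hg2
    refine ⟨Algebra.lsmul K K N (a (vertex (r e))) ∘ₗ g ∘ₗ Algebra.lsmul K K M (a (vertex (s e))),
      fun m => ?_, fun m => ?_, fun m => ?_, fun f m => ?_⟩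
    · simp only [LinearMap.comp_apply, Algebra.lsmul_coe, map_smul, hg2, δa, smul_sub, hσv, gsv,
        grv]
      rw [← hσv, grv]
    · simp only [LinearMap.comp_apply, Algebra.lsmul_coe, ← mul_smul, ha.videm]
    · simp only [LinearMap.comp_apply, Algebra.lsmul_coe, ← mul_smul, ha.videm]
    · simp only [LinearMap.comp_apply, Algebra.lsmul_coe]
      by_cases hef : s e = s f
      · rw [hef, esv, ← βs, hg1, hs, smul_neg, grv]
      · rw [← esv, ← mul_smul, ha.vorth _ _ hef, zero_smul, map_zero, smul_zero, ← gsv, ← Ds f,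
          ← mul_smul (a (vertex (s e))), ha.vorth _ _ hef, zero_smul, smul_zero, neg_zero]
  choose G pG Gr Gs GD using hG
  let Δ : LPAGen V E → M →ₗ[K] N := fun g =>
    match g with
    | vertex _ => 0
    | edge e => D e
    | ghost e => G e
  have pΔ : ∀ g m, p (Δ g m) = δ g m := by
    rintro (v | e | e) m
    · simp [Δ, δa, hσv]
    · exact pD e m
    · exact pG e m
  let b : LPAGen V E → Module.End K (N × M) := fun g =>
    LinearMap.prod
      (Algebra.lsmul K K N (a g) ∘ₗ LinearMap.fst K N M + Δ g ∘ₗ LinearMap.snd K N M)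
      (Algebra.lsmul K K M (a g) ∘ₗ LinearMap.snd K N M)
  have ba : ∀ g n m, b g (n, m) = (a g • n + Δ g m, a g • m) := fun g n m => rfl
  have bv : ∀ v n m, b (vertex v) (n, m) = (a (vertex v) • n, a (vertex v) • m) :=
    fun v n m => by simp [ba, Δ]
  have be : ∀ e n m, b (edge e) (n, m) = (a (edge e) • n + D e m, a (edge e) • m) :=
    fun v n m => rfl
  have bg : ∀ e n m, b (ghost e) (n, m) = (a (ghost e) • n + G e m, a (ghost e) • m) :=
    fun v n m => rfl
  refine ⟨σ, b, hσ, ?_, ?_, ?_⟩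
  · have ext' : ∀ {f g : Module.End K (N × M)}, (∀ n m, f (n, m) = g (n, m)) → f = g :=
      fun h => LinearMap.ext fun x => h x.1 x.2
    constructor
    · intro v w h; refine ext' fun n m => ?_
      simp [bv, ← mul_smul, ha.vorth _ _ h]
    · intro v; refine ext' fun n m => ?_
      simp [bv, ← mul_smul, ha.videm]
    · intro e; refine ext' fun n m => ?_
      simp [bv, be, esv, Ds]
    · intro e; refine ext' fun n m => ?_
      simp [bv, be, erv, Dr]
    · intro e; refine ext' fun n m => ?_
      simp [bv, bg, grv, Gr]
    · intro e; refine ext' fun n m => ?_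
      simp [bv, bg, gsv, Gs]
    · intro e f h; refine ext' fun n m => ?_
      simp [be, bg, GD, ← mul_smul, ha.ck1d _ _ h]
    · intro e; refine ext' fun n m => ?_
      simp [be, bg, bv, GD, ← mul_smul, ha.ck1s]
    · intro v h hne; refine ext' fun n m => ?_
      have hv := ha.ck2 v h hne
      have h2 : ∀ {X : Type} [AddCommGroup X] [Module L X] (x : X),
          ∑ e ∈ h.toFinset, a (edge e) • a (ghost e) • x = a (vertex v) • x := fun x => by
        rw [hv, Finset.sum_smul]; simp only [mul_smul]
      have hsv : ∀ e ∈ h.toFinset, s e = v := fun e he => by simpa using he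
      have h3 : ∀ e ∈ h.toFinset, G e m =
          - (a (ghost e) • ∑ f ∈ h.toFinset, D f (a (ghost f) • m)) := fun e he => by
        rw [← Gs, hsv e he, ← h2, map_sum, Finset.smul_sum, ← Finset.sum_neg_distrib]
        exact Finset.sum_congr rfl fun f _ => GD e f _
      have h4 : ∑ e ∈ h.toFinset, a (edge e) • G e m
          = - ∑ f ∈ h.toFinset, D f (a (ghost f) • m) := by
        rw [Finset.sum_congr rfl fun e he => by rw [h3 e he, smul_neg], Finset.sum_neg_distrib, h2,
          Finset.smul_sum]
        congr 1
        refine Finset.sum_congr rfl fun f hf => ?_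
        rw [← hsv f hf, Ds]
      rw [LinearMap.sum_apply, bv]
      simp only [Module.End.mul_apply, bg, be, smul_add]
      refine Prod.ext ?_ ?_
      · rw [Prod.fst_sum]
        simp only [Finset.sum_add_distrib]
        rw [h2, h4]; abel
      · rw [Prod.snd_sum]
        exact (h2 m).symm
    · refine ext' fun n m => ?_
      rw [LinearMap.sum_apply]
      simp only [bv]
      refine Prod.ext ?_ ?_
      · rw [Prod.fst_sum, ← Finset.sum_smul, ← ha.unit]; simp
      · rw [Prod.snd_sum, ← Finset.sum_smul, ← ha.unit]; simp
  · intro g n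
    simp [ba]
  · intro g n m
    simp only [ba, map_add, map_smul, pΔ, δa, smul_add]
    abel

theorem hereditary_of {L : Type} [Ring L] [Algebra K L] {a : LPAGen V E → L} (ha : LRel s r a)
    (hlift : ∀ (A : Type) [Ring A] [Algebra K A] (b : LPAGen V E → A), LRel s r b →
      ∃ ρ : L →ₐ[K] A, ∀ g, ρ (a g) = b g)
    (hind : ∀ {C : L → Prop} (h0 : ∀ k : K, C (algebraMap K _ k)) (h1 : ∀ g, C (a g))
      (hm : ∀ x y, C x → C y → C (x * y)) (ha : ∀ x y, C x → C y → C (x + y)) (x), C x) :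
    ∀ I : Submodule L L, Module.Projective L I := by
  intro I
  refine Module.Projective.of_lifting_property'' fun f hf => ?_
  have hpq : ∀ t, I.mkQ t = 0 ↔ ∃ n, (I.subtype ∘ₗ f) n = t := fun t => by
    rw [Submodule.mkQ_apply, Submodule.Quotient.mk_eq_zero]
    constructor
    · intro ht
      obtain ⟨n, hn⟩ := hf ⟨t, ht⟩
      exact ⟨n, by simp [hn]⟩
    · rintro ⟨n, rfl⟩
      simp
  obtain ⟨σ, b, hσ, hb, hb0, hbp⟩ := exists_action (K := K)
    ha (I.subtype ∘ₗ f) I.mkQ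
    I.mkQ_surjective hpq
  obtain ⟨ρ, hρ⟩ := hlift _ _ hb
  -- `ρ` restricts to the given action on the first factor
  have h1 : ∀ x n, ρ x (n, 0) = (x • n, 0) := by
    intro x
    induction x using hind with
    | h0 k => intro n; simp [Module.algebraMap_end_apply]
    | h1 g => intro n; rw [hρ, hb0]
    | hm x y hx hy => intro n; rw [map_mul, Module.End.mul_apply, hy, hx, mul_smul]
    | ha x y hx hy => intro n; rw [map_add, LinearMap.add_apply, hy, hx, add_smul]; simp
  have h2 : ∀ x z, (f (ρ x z).1 : L) + σ (ρ x z).2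
      = x * (f z.1 + σ z.2) := by
    intro x
    induction x using hind with
    | h0 k =>
      intro z
      rw [AlgHom.commutes, Module.algebraMap_end_apply, ← Algebra.smul_def, smul_add,
        Prod.smul_fst, Prod.smul_snd, map_smul σ, ← algebraMap_smul (L) k z.1,
        map_smul f, Submodule.coe_smul, algebraMap_smul]
    | h1 g => intro z; rw [hρ]; exact hbp g z.1 z.2
    | hm x y hx hy => intro z; rw [map_mul, Module.End.mul_apply, hx, hy, mul_assoc]
    | ha x y hx hy =>
      intro z
      rw [map_add, LinearMap.add_apply, add_mul, ← hx, ← hy, Prod.fst_add, Prod.snd_add,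
        map_add, map_add, Submodule.coe_add]
      abel
  -- lift `1`
  obtain ⟨ξ, hξ⟩ : ∃ ξ : (I →₀ L) × (_ ⧸ I),
      (f ξ.1 : L) + σ ξ.2 = 1 := by
    obtain ⟨n, hn⟩ := (hpq (1 - σ (I.mkQ 1))).1 (by rw [map_sub, hσ, sub_self])
    refine ⟨(n, I.mkQ 1), ?_⟩
    have : (f n : L) = 1 - σ (I.mkQ 1) := hn
    simp only [this, sub_add_cancel]
  have h3 : ∀ x, (f (ρ x ξ).1 : L) + σ (ρ x ξ).2 = x := fun x => by
    rw [h2, hξ, mul_one]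
  have h4 : ∀ x ∈ I, (ρ x ξ).2 = 0 := fun x hx => by
    have h5 := congrArg I.mkQ (h3 x)
    rw [map_add, hσ, (hpq (f (ρ x ξ).1 : L)).2 ⟨_, rfl⟩, zero_add] at h5
    rw [h5]
    simpa using hx
  refine ⟨{ toFun := fun x => (ρ x ξ).1, map_add' := fun x y => ?_, map_smul' := fun c x => ?_ },
    ?_⟩
  · simp
  · have h6 : ρ (x : L) ξ = ((ρ x ξ).1, 0) :=
      Prod.ext rfl (h4 x x.2)
    simp only [Submodule.coe_smul, smul_eq_mul, map_mul, Module.End.mul_apply, RingHom.id_apply]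
    rw [h6, h1]
  · ext x
    have h7 := h3 x
    rw [h4 x x.2, map_zero, add_zero] at h7
    simp [h7]

end main

end LPAHered

/-- For a directed graph `E` with finitely many vertices and a field `K`,
the Leavitt path algebra `L = L_K(E)` is hereditary: every left ideal of `L` is
projective as a left `L`-module. -/
theorem lpa_hereditary (K V E : Type) [Field K] [Fintype V] (s r : E → V) :
    ∀ I : Submodule (LeavittPathAlgebra K V E s r) (LeavittPathAlgebra K V E s r),
      Module.Projective (LeavittPathAlgebra K V E s r) I := by
  exact LPAHered.hereditary_of (K := K) LPAHered.gen_rel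
    (fun _ _ _ _ hb => LPAHered.exists_lift hb)
    (fun h0 h1 hm ha x => LPAHered.gen_induction h0 h1 hm ha x)
end

section
/- Let E be a directed graph with E⁰ finite and K a field, and let L = L_K(E) be the (unital) Leavitt path algebra. Then L is a Bézout ring: every finitely generated left ideal of L is a principal left ideal, i.e., of the form La for some a ∈ L. -/
set_option linter.unusedSectionVars false

namespace LPAB

section paths
variable {V E : Type} (s r : E → V)

def IsPath : V → List E → V → Prop
  | u, [], v => u = v
  | u, e :: l, v => s e = u ∧ IsPath (r e) l v

def Reach (u v : V) : Prop := ∃ l, IsPath s r u l v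

def Abundant (w : V) : Prop :=
  ∃ e f, e ≠ f ∧ s e = s f ∧ Reach s r (r e) (s e) ∧ Reach s r (r f) w

def Cyc (v : V) : Prop := ∃ e, s e = v ∧ Reach s r (r e) v

variable {s r}

theorem IsPath.append {u v w : V} {l m : List E} (h : IsPath s r u l v) (h' : IsPath s r v m w) :
    IsPath s r u (l ++ m) w := by
  induction l generalizing u with
  | nil => cases h; exact h'
  | cons e l ih => exact ⟨h.1, ih h.2⟩

theorem IsPath.split {u w : V} {l m : List E} (h : IsPath s r u (l ++ m) w) :
    ∃ v, IsPath s r u l v ∧ IsPath s r v m w := by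
  induction l generalizing u with
  | nil => exact ⟨u, rfl, h⟩
  | cons e l ih =>
    obtain ⟨v, h1, h2⟩ := ih h.2
    exact ⟨v, ⟨h.1, h1⟩, h2⟩

theorem IsPath.det {u v w : V} {l : List E} (h : IsPath s r u l v) (h' : IsPath s r u l w) :
    v = w := by
  induction l generalizing u with
  | nil => exact h.symm.trans h'
  | cons e l ih => exact ih h.2 h'.2

theorem Reach.refl (u : V) : Reach s r u u := ⟨[], rfl⟩

theorem Reach.trans {u v w : V} (h : Reach s r u v) (h' : Reach s r v w) : Reach s r u w := by
  obtain ⟨l, hl⟩ := h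
  obtain ⟨m, hm⟩ := h'
  exact ⟨l ++ m, hl.append hm⟩

theorem Reach.edge (e : E) : Reach s r (s e) (r e) := ⟨[e], rfl, rfl⟩

theorem Abundant.reach {u v : V} (h : Abundant s r u) (huv : Reach s r u v) : Abundant s r v := by
  obtain ⟨e, f, h1, h2, h3, h4⟩ := h
  exact ⟨e, f, h1, h2, h3, h4.trans huv⟩

/-- From a cyclic vertex, everything non-abundant that can be reached reaches back. -/
theorem reach_back {w u' : V} {d : List E} (hd : IsPath s r w d u') (hw : Cyc s r w)
    (hu : ¬ Abundant s r u') : Reach s r u' w := by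
  induction d generalizing w with
  | nil => cases hd; exact Reach.refl _
  | cons f d ih =>
    obtain ⟨hf, hd⟩ := hd
    obtain ⟨e, he, hr⟩ := hw
    by_cases hef : e = f
    · subst hef
      have hc : Cyc s r (r e) := by
        obtain ⟨l, hl⟩ := hr
        cases l with
        | nil =>
          have : r e = w := hl
          exact ⟨e, he.trans this.symm, this ▸ Reach.refl _⟩
        | cons g l =>
          refine ⟨g, hl.1, ?_⟩
          exact Reach.trans ⟨l, hl.2⟩ (he ▸ Reach.edge e)
      exact (ih hd hc).trans hr
    · exact absurd ⟨e, f, hef, he.trans hf.symm, he ▸ hr, ⟨d, hd⟩⟩ hu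

theorem prefix_cmp {v u u' : V} {c d : List E} (hc : IsPath s r v c u) (hd : IsPath s r v d u')
    (hr : Reach s r u v) (hu : ¬ Abundant s r u') : c <+: d ∨ d <+: c := by
  induction c generalizing v d with
  | nil => exact Or.inl (List.nil_prefix)
  | cons e c ih =>
    cases d with
    | nil => exact Or.inr (List.nil_prefix)
    | cons f d =>
      by_cases hef : e = f
      · subst hef
        rcases ih hc.2 hd.2 (hr.trans (hc.1 ▸ Reach.edge e)) with h | h
        · left; simpa using h
        · right; simpa using h
      · exfalso
        apply hu
        refine ⟨e, f, hef, hc.1.trans hd.1.symm, ?_, ⟨d, hd.2⟩⟩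
        rw [hc.1]
        exact Reach.trans ⟨c, hc.2⟩ hr

variable (s r)

def mutSetoid : Setoid V where
  r u v := Reach s r u v ∧ Reach s r v u
  iseqv := ⟨fun u => ⟨Reach.refl u, Reach.refl u⟩, fun h => ⟨h.2, h.1⟩,
    fun h h' => ⟨h.1.trans h'.1, h'.2.trans h.2⟩⟩

noncomputable def rep (v : V) : V := (Quotient.mk (mutSetoid s r) v).out

theorem rep_mut (v : V) : Reach s r (rep s r v) v ∧ Reach s r v (rep s r v) :=
  Quotient.exact (s := mutSetoid s r) (Quotient.out_eq (Quotient.mk (mutSetoid s r) v))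

theorem rep_eq {u v : V} (h : Reach s r u v) (h' : Reach s r v u) : rep s r u = rep s r v := by
  unfold rep
  rw [Quotient.sound (s := mutSetoid s r) (show (mutSetoid s r).r u v from ⟨h, h'⟩)]

def Sink (v : V) : Prop := ∀ e, s e ≠ v

/-- Non-abundant targets. -/
def Tgt (u : V) : Prop := ¬ Abundant s r u ∧ (Sink s u ∨ (Cyc s r u ∧ rep s r u = u))

variable {s r}

theorem tgt_sep {u u' : V} (h : Tgt s r u) (h' : Tgt s r u') (hr : Reach s r u u') : u = u' := by
  obtain ⟨d, hd⟩ := hr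
  rcases h.2 with hs | ⟨hc, hrep⟩
  · cases d with
    | nil => exact hd
    | cons e d => exact absurd hd.1 (hs e)
  · have hb := reach_back hd hc h'.1
    rcases h'.2 with hs' | ⟨hc', hrep'⟩
    · obtain ⟨l, hl⟩ := hb
      cases l with
      | nil => exact hl.symm
      | cons e d => exact absurd hl.1 (hs' e)
    · rw [← hrep, ← hrep']
      exact rep_eq s r ⟨d, hd⟩ hb

variable (s r) in
inductive Red : V → Prop
  | ab (v : V) : Abundant s r v → Red v
  | tgt (v : V) : Tgt s r v → Red v
  | step (v : V) : ¬ Sink s v → (∀ e, s e = v → Red (r e)) → Red v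

theorem red_all [Finite V] (v : V) : Red s r v := by
  classical
  by_contra hv
  -- minimal set of descendants
  obtain ⟨v, hv, hmin⟩ : ∃ v, ¬ Red s r v ∧ ∀ w, ¬ Red s r w →
      (Set.ncard {x | Reach s r v x}) ≤ Set.ncard {x | Reach s r w x} := by
    let f : {v // ¬ Red s r v} → ℕ := fun w => Set.ncard {x | Reach s r w.1 x}
    have : Nonempty {v // ¬ Red s r v} := ⟨⟨v, hv⟩⟩
    exact ⟨(Function.argmin f).1, (Function.argmin f).2, fun w hw =>
      Function.argmin_le f ⟨w, hw⟩⟩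
  have hback : ∀ w, Reach s r v w → ¬ Red s r w → Reach s r w v := by
    intro w hw hn
    have hsub : {x | Reach s r w x} ⊆ {x | Reach s r v x} := fun x hx => hw.trans hx
    have := Set.eq_of_subset_of_ncard_le hsub (hmin w hn) (Set.toFinite _)
    have h2 : v ∈ {x | Reach s r w x} := this ▸ (Reach.refl v : Reach s r v v)
    exact h2
  have hsucc : ∀ w, ¬ Red s r w → ∃ e, s e = w ∧ ¬ Red s r (r e) := by
    intro w hw
    by_contra hcon
    push Not at hcon
    apply hw
    by_cases hs : Sink s w
    · by_cases ha : Abundant s r w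
      · exact Red.ab _ ha
      · exact Red.tgt _ ⟨ha, Or.inl hs⟩
    · exact Red.step _ hs hcon
  have hna : ∀ w, ¬ Red s r w → ¬ Abundant s r w := fun w hw ha => hw (Red.ab _ ha)
  have hwalk : ∀ (l : List E) (w m : V), IsPath s r w l m → Reach s r v w → ¬ Red s r w →
      Reach s r m v → ¬ Red s r m := by
    intro l
    induction l with
    | nil => intro w m h _ h2 _; cases h; exact h2
    | cons f l ih =>
      intro w m h h1 h2 h3
      obtain ⟨e, he, hn⟩ := hsucc w h2
      have hvre : Reach s r v (r e) := h1.trans (he ▸ Reach.edge e)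
      by_cases hef : e = f
      · subst hef
        exact ih _ _ h.2 hvre hn h3
      · exfalso
        apply hna w h2
        refine ⟨e, f, hef, he.trans h.1.symm, ?_, ?_⟩
        · rw [he]; exact (hback _ hvre hn).trans h1
        · exact Reach.trans ⟨l, h.2⟩ (h3.trans h1)
  obtain ⟨h1, h2⟩ := rep_mut s r v
  obtain ⟨l, hl⟩ := h2
  have hm := hwalk l v _ hl (Reach.refl v) hv h1
  obtain ⟨e, he, hn⟩ := hsucc _ hm
  apply hm
  refine Red.tgt _ ⟨hna _ hm, Or.inr ⟨⟨e, he, ?_⟩, ?_⟩⟩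
  · have : Reach s r v (r e) := Reach.trans ⟨l, hl⟩ (he ▸ Reach.edge e)
    exact (hback _ this hn).trans ⟨l, hl⟩
  · exact rep_eq s r h1 ⟨l, hl⟩

variable (s r) in
/-- first-visit paths to `u`. -/
def FV (p : List E) (u : V) : Prop :=
  (∃ w, IsPath s r w p u) ∧ ∀ p' d, p = p' ++ d → IsPath s r u d u → d = []

/-- closed paths at a non-abundant vertex are powers of a single one. -/
theorem closed_pow {u : V} (hu : ¬ Abundant s r u) (c : List E) (hc : IsPath s r u c u)
    (hmin : ∀ d, IsPath s r u d u → d ≠ [] → c.length ≤ d.length) :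
    ∀ (d : List E), IsPath s r u d u →
      d = [] ∨ ∃ d', d = c ++ d' ∧ IsPath s r u d' u := by
  intro d hd
  by_cases hd0 : d = []
  · exact Or.inl hd0
  right
  rcases prefix_cmp hc hd (Reach.refl u) hu with ⟨t, ht⟩ | h
  · refine ⟨t, ht.symm, ?_⟩
    rw [← ht] at hd
    obtain ⟨x, h1, h2⟩ := hd.split
    have hx := hc.det h1
    subst hx
    exact h2
  · have := h.eq_of_length_le (hmin d hd hd0)
    exact ⟨[], by simp [this], rfl⟩

end paths

theorem pid_lemma {D M ι : Type*} [CommRing D] [IsDomain D] [IsPrincipalIdealRing D]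
    [AddCommGroup M] [Module D M] (m : ι → M) (B : Set M) (hB : B.Finite)
    (hs : B ⊆ Submodule.span D (Set.range m)) :
    ∃ (F : Finset ι) (b : ι → M), Submodule.span D (b '' F) = Submodule.span D B := by
  classical
  have hs' : ∀ x ∈ B, ∃ f : ι →₀ D, Finsupp.linearCombination D m f = x := fun x hx =>
    (Finsupp.mem_span_range_iff_exists_finsupp).1 (hs hx)
  choose! f hf using hs'
  let F : Finset ι := hB.toFinset.biUnion fun x => (f x).support
  let φ : (F → D) →ₗ[D] M := Fintype.linearCombination D (fun i : F => m i)
  let g : M → (F → D) := fun x i => f x i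
  have hφ : ∀ x ∈ B, φ (g x) = x := by
    intro x hx
    refine Eq.trans ?_ (hf x hx)
    simp only [φ, g, Fintype.linearCombination_apply]
    rw [Finsupp.linearCombination_apply, Finsupp.sum_of_support_subset (s := F)]
    · rw [← Finset.sum_coe_sort F]
    · intro i hi
      exact Finset.mem_biUnion.2 ⟨x, by simpa using hx, hi⟩
    · simp
  let N : Submodule D (F → D) := Submodule.span D (g '' B)
  have hN : N.map φ = Submodule.span D B := by
    simp only [N, Submodule.map_span]
    congr 1
    rw [Set.image_image]
    ext y
    constructor
    · rintro ⟨x, hx, rfl⟩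
      simpa [hφ x hx] using hx
    · intro hy
      exact ⟨y, hy, hφ y hy⟩
  obtain ⟨n, bN⟩ := Submodule.basisOfPid (Pi.basisFun D F) N
  have hn : n ≤ F.card := by
    have h1 := Module.finrank_eq_card_basis bN
    have h2 := Submodule.finrank_le N
    simp at h1 h2
    omega
  let emb : Fin n ↪ F := (Fin.castLEEmb hn).trans F.equivFin.symm.toEmbedding
  let b : ι → M := fun i => if h : ∃ k, (emb k : ι) = i then φ (bN h.choose) else 0
  have hb : ∀ k, b (emb k) = φ (bN k) := by
    intro k
    have h : ∃ k', (emb k' : ι) = emb k := ⟨k, rfl⟩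
    have : h.choose = k := emb.injective (Subtype.ext h.choose_spec)
    simp only [b]
    rw [dif_pos h, this]
  refine ⟨F, b, ?_⟩
  rw [← hN]
  have hspan : N = Submodule.span D (Set.range fun k => (bN k : F → D)) := by
    have h := congrArg (Submodule.map N.subtype) bN.span_eq
    rw [Submodule.map_span, Submodule.map_subtype_top, ← Set.range_comp] at h
    exact h.symm
  apply le_antisymm
  · rw [Submodule.span_le]
    rintro _ ⟨i, hi, rfl⟩
    simp only [b]
    split_ifs with h
    · exact Submodule.mem_map_of_mem (bN _).2
    · exact Submodule.zero_mem _
  · rw [hspan, Submodule.map_span, Submodule.span_le]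
    rintro _ ⟨_, ⟨k, rfl⟩, rfl⟩
    exact Submodule.subset_span ⟨emb k, (emb k).2, hb k⟩


section fam
variable {K R V E : Type} [Field K] [Ring R] [Algebra K R] [Fintype V] [Fintype E]

structure LFam (s r : E → V) (P : V → R) (S T : E → R) : Prop where
  PP : ∀ v w, v ≠ w → P v * P w = 0
  Pi : ∀ v, P v * P v = P v
  PS : ∀ e, P (s e) * S e = S e
  SP : ∀ e, S e * P (r e) = S e
  PT : ∀ e, P (r e) * T e = T e
  TP : ∀ e, T e * P (s e) = T e
  TS0 : ∀ e f, e ≠ f → T e * S f = 0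
  TS : ∀ e, T e * S e = P (r e)
  ck2 : ∀ v, P v ∈ Submodule.span R (T '' {e | s e = v}) ∨ Sink s v
  one : 1 = ∑ v, P v

def Sw (S : E → R) : List E → R
  | [] => 1
  | e :: l => S e * Sw S l

def Tw (T : E → R) : List E → R
  | [] => 1
  | e :: l => Tw T l * T e

theorem Tw_append (T : E → R) (l m : List E) : Tw T (l ++ m) = Tw T m * Tw T l := by
  induction l with
  | nil => simp [Tw]
  | cons e l ih => simp [Tw, ih, mul_assoc]

variable {s r : E → V} {P : V → R} {S T : E → R}

theorem PSw (h : LFam s r P S T) {v u : V} {l : List E} (hl : IsPath s r v l u) :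
    P v * (Sw S l * P u) = Sw S l * P u := by
  cases l with
  | nil => cases hl; simp [Sw, h.Pi]
  | cons e l => rw [← hl.1]; simp only [Sw, ← mul_assoc, h.PS]

theorem TwP (h : LFam s r P S T) {v u : V} {l : List E} (hl : IsPath s r v l u) :
    P u * Tw T l * P v = P u * Tw T l := by
  cases l with
  | nil => cases hl; simp [Tw, h.Pi]
  | cons e l => rw [← hl.1]; simp only [Tw, mul_assoc, h.TP]

theorem TS_self (h : LFam s r P S T) {v u : V} {l : List E} (hl : IsPath s r v l u) :
    P u * Tw T l * (Sw S l * P u) = P u := by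
  induction l generalizing v with
  | nil => simp [Tw, Sw, h.Pi]
  | cons e l ih =>
    have := ih hl.2
    have h1 := TwP h hl.2
    calc P u * (Tw T l * T e) * (S e * Sw S l * P u)
        = P u * Tw T l * (T e * S e) * (Sw S l * P u) := by simp only [mul_assoc]
      _ = P u := by rw [h.TS, h1, this]

theorem TS_orth (h : LFam s r P S T) {v u v' u' : V} {l l' : List E} (hl : IsPath s r v l u)
    (hl' : IsPath s r v' l' u') (h1 : ∀ d, l' = l ++ d → ¬ IsPath s r u d u')
    (h2 : ∀ d, l = l' ++ d → ¬ IsPath s r u' d u) :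
    P u * Tw T l * (Sw S l' * P u') = 0 := by
  induction l generalizing v v' l' with
  | nil =>
    cases l' with
    | nil =>
      have : u ≠ u' := h1 [] rfl
      simp [Tw, Sw, h.PP _ _ this]
    | cons f l' =>
      have : u ≠ s f := by
        intro hu
        exact h1 (f :: l') rfl ⟨hu.symm, hl'.2⟩
      simp only [Tw, Sw, mul_one]
      rw [← h.PS f]
      simp only [← mul_assoc, h.PP _ _ this, zero_mul]
  | cons e l ih =>
    cases l' with
    | nil =>
      have : s e ≠ u' := by
        intro hu
        exact h2 (e :: l) rfl ⟨hu, hl.2⟩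
      simp only [Tw, Sw, one_mul]
      rw [← h.TP e]
      simp only [mul_assoc, h.PP _ _ this, mul_zero]
    | cons f l' =>
      have hcalc : P u * Tw T (e :: l) * (Sw S (f :: l') * P u')
          = P u * Tw T l * (T e * S f) * (Sw S l' * P u') := by
        simp only [Tw, Sw, mul_assoc]
      rw [hcalc]
      by_cases hef : e = f
      · subst hef
        rw [h.TS, TwP h hl.2]
        refine ih hl.2 hl'.2 ?_ ?_
        · intro d hd; exact h1 d (by simp [hd])
        · intro d hd; exact h2 d (by simp [hd])
      · rw [h.TS0 _ _ hef]; simp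

/-- absorbing an abundant element into a principal left ideal -/
theorem absorb (h : LFam s r P S T) {w : V} (hw : Abundant s r w) (z b : R) (hb : P w * b = b) :
    ∃ z', Submodule.span R {z'} = Submodule.span R {z, b} := by
  obtain ⟨e, f, hef, hs, ⟨l, hl⟩, ⟨m, hm⟩⟩ := hw
  set v := s e with hv
  have hc : IsPath s r v (e :: l) v := ⟨rfl, hl⟩
  have hq : IsPath s r v (f :: m) w := ⟨hs.symm, hm⟩
  set c := Sw S (e :: l) * P v with hcd
  set c' := P v * Tw T (e :: l) with hcd'
  set q := Sw S (f :: m) * P w with hqd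
  set q' := P w * Tw T (f :: m) with hqd'
  have e1 : c' * c = P v := TS_self h hc
  have e2 : q' * q = P w := TS_self h hq
  have e3 : c' * q = 0 := by
    refine TS_orth h hc hq ?_ ?_ <;> · intro d hd; simp at hd; exact absurd hd.1 (by tauto)
  have e4 : q' * c = 0 := by
    refine TS_orth h hq hc ?_ ?_ <;> · intro d hd; simp at hd; exact absurd hd.1 (by tauto)
  have e5 : P v * c = c := PSw h hc
  have e6 : P v * q = q := PSw h hq
  have e7 : c' * P v = c' := TwP h hc
  have e8 : q' * P v = q' := TwP h hq
  let z' := (1 - P v) * z + c * z + q * b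
  have f1 : c' * z' = P v * z := by
    have : c' * z' = (c' - c' * P v) * z + (c' * c) * z + (c' * q) * b := by
      simp only [z']; noncomm_ring
    rw [this, e7, e1, e3]; simp
  have f2 : q' * z' = b := by
    have : q' * z' = (q' - q' * P v) * z + (q' * c) * z + (q' * q) * b := by
      simp only [z']; noncomm_ring
    rw [this, e8, e2, e4]; simp [hb]
  have f3 : (1 - P v) * z' = (1 - P v) * z := by
    have : (1 - P v) * z' = z - P v * z - P v * z + (P v * P v) * z + (c - P v * c) * z
        + (q - P v * q) * b := by
      simp only [z']; noncomm_ring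
    rw [this, e5, e6, h.Pi]; noncomm_ring
  refine ⟨z', le_antisymm ?_ ?_⟩
  · rw [Submodule.span_singleton_le_iff_mem]
    have hz : z ∈ Submodule.span R {z, b} := Submodule.subset_span (by simp)
    have hb : b ∈ Submodule.span R {z, b} := Submodule.subset_span (by simp)
    exact Submodule.add_mem _ (Submodule.add_mem _ (Submodule.smul_mem _ _ hz)
      (Submodule.smul_mem _ _ hz)) (Submodule.smul_mem _ _ hb)
  · rw [Submodule.span_le]
    have hz' : z' ∈ Submodule.span R {z'} := Submodule.mem_span_singleton_self _
    rintro x (rfl | rfl)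
    · have : x = (1 - P v) * z' + c' * z' := by rw [f1, f3]; noncomm_ring
      rw [this]
      exact Submodule.add_mem _ (Submodule.smul_mem _ _ hz') (Submodule.smul_mem _ _ hz')
    · have hq := Submodule.smul_mem (Submodule.span R {z'}) q' hz'
      rwa [smul_eq_mul, f2] at hq

/-- combining an orthogonal family -/
theorem combine (h : LFam s r P S T) (F : Finset (V × List E))
    (hF : ∀ i ∈ F, Tgt s r i.1 ∧ FV s r i.2 i.1) (b : V × List E → R)
    (hb : ∀ i ∈ F, P i.1 * b i = b i) :
    ∃ x, Submodule.span R {x} = Submodule.span R (b '' F) := by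
  classical
  let x := ∑ i ∈ F, Sw S i.2 * b i
  have key : ∀ i ∈ F, P i.1 * Tw T i.2 * x = b i := by
    intro i hi
    simp only [x, Finset.mul_sum]
    rw [Finset.sum_eq_single i]
    · obtain ⟨_, ⟨⟨w, hw⟩, _⟩⟩ := hF i hi
      rw [← hb i hi]
      have := TS_self h hw
      rw [← mul_assoc (Sw S i.2), ← mul_assoc, this]
    · intro j hj hji
      obtain ⟨ti, ⟨⟨w, hw⟩, fi⟩⟩ := hF i hi
      obtain ⟨tj, ⟨⟨w', hw'⟩, fj⟩⟩ := hF j hj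
      have := TS_orth h hw hw' (by
          intro d hd hp
          have hij := tgt_sep ti tj ⟨d, hp⟩
          have := fj i.2 d hd (hij ▸ hp)
          subst this
          exact hji (Prod.ext hij.symm (by simpa using hd)))
        (by
          intro d hd hp
          have hij := tgt_sep tj ti ⟨d, hp⟩
          have := fi j.2 d hd (hij ▸ hp)
          subst this
          exact hji (Prod.ext hij (by simpa using hd.symm)))
      rw [← hb j hj, ← mul_assoc (Sw S j.2), ← mul_assoc, this, zero_mul]
    · intro hn; exact absurd hi hn
  refine ⟨x, le_antisymm ?_ ?_⟩
  · rw [Submodule.span_singleton_le_iff_mem]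
    exact Submodule.sum_mem _ fun i hi =>
      Submodule.smul_mem _ _ (Submodule.subset_span ⟨i, hi, rfl⟩)
  · rw [Submodule.span_le]
    rintro _ ⟨i, hi, rfl⟩
    rw [← key i hi]
    exact Submodule.smul_mem _ _ (Submodule.mem_span_singleton_self _)

variable (K) in
/-- span of ghost paths -/
def MA (s r : E → V) (P : V → R) (T : E → R) : Submodule K R :=
  Submodule.span K {x | ∃ w q v, IsPath s r w q v ∧ x = P v * Tw T q}

theorem MA_P (h : LFam s r P S T) (v : V) {a : R} (ha : a ∈ MA K s r P T) :
    P v * a ∈ MA K s r P T := by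
  have : MA K s r P T ≤ (MA K s r P T).comap (LinearMap.mulLeft K (P v)) := by
    conv_lhs => rw [MA]
    rw [Submodule.span_le]
    rintro _ ⟨w, q, u, hq, rfl⟩
    simp only [Submodule.comap_coe, Set.mem_preimage, LinearMap.mulLeft_apply, SetLike.mem_coe]
    by_cases hv : v = u
    · subst hv
      rw [← mul_assoc, h.Pi]
      exact Submodule.subset_span ⟨w, q, v, hq, rfl⟩
    · rw [← mul_assoc, h.PP _ _ hv, zero_mul]
      exact Submodule.zero_mem _
  exact this ha

theorem MA_T (h : LFam s r P S T) (e : E) {a : R} (ha : a ∈ MA K s r P T) :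
    T e * a ∈ MA K s r P T := by
  have : MA K s r P T ≤ (MA K s r P T).comap (LinearMap.mulLeft K (T e)) := by
    conv_lhs => rw [MA]
    rw [Submodule.span_le]
    rintro _ ⟨w, q, u, hq, rfl⟩
    simp only [Submodule.comap_coe, Set.mem_preimage, LinearMap.mulLeft_apply, SetLike.mem_coe]
    by_cases hv : s e = u
    · subst hv
      rw [← mul_assoc, h.TP]
      refine Submodule.subset_span ⟨w, q ++ [e], r e, hq.append ⟨rfl, rfl⟩, ?_⟩
      rw [Tw_append]
      simp [Tw, ← mul_assoc, h.PT]
    · rw [← h.TP e, mul_assoc, ← mul_assoc (P (s e)), h.PP _ _ hv, zero_mul, mul_zero]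
      exact Submodule.zero_mem _
  exact this ha

theorem MA_one (h : LFam s r P S T) : (1 : R) ∈ MA K s r P T := by
  rw [h.one]
  exact Submodule.sum_mem _ fun v _ => Submodule.subset_span ⟨v, [], v, rfl, by simp [Tw]⟩

variable (K) in
def Gd (s r : E → V) (P : V → R) (T : E → R) : ℕ → Submodule K R
  | 0 => MA K s r P T
  | n + 1 => (⨅ v : {v // Sink s v}, (MA K s r P T).comap (LinearMap.mulLeft K (P v))) ⊓
      ⨅ e, (Gd s r P T n).comap (LinearMap.mulLeft K (T e))

theorem Gd_succ {n : ℕ} {a : R} : a ∈ Gd K s r P T (n + 1) ↔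
    (∀ v, Sink s v → P v * a ∈ MA K s r P T) ∧ ∀ e, T e * a ∈ Gd K s r P T n := by
  simp [Gd]

theorem Gd_mono1 (h : LFam s r P S T) {n : ℕ} : ∀ {a : R}, a ∈ Gd K s r P T n →
    a ∈ Gd K s r P T (n + 1) := by
  induction n with
  | zero => intro a ha; exact Gd_succ.2 ⟨fun v _ => MA_P h v ha, fun e => MA_T h e ha⟩
  | succ n ih =>
    intro a ha
    rw [Gd_succ] at ha ⊢
    exact ⟨ha.1, fun e => ih (ha.2 e)⟩

theorem Gd_mono (h : LFam s r P S T) {n m : ℕ} (hnm : n ≤ m) {a : R}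
    (ha : a ∈ Gd K s r P T n) : a ∈ Gd K s r P T m := by
  induction hnm with
  | refl => exact ha
  | step _ ih => exact Gd_mono1 h ih

theorem Gd_P (h : LFam s r P S T) {n : ℕ} (v : V) {a : R} (ha : a ∈ Gd K s r P T n) :
    P v * a ∈ Gd K s r P T n := by
  cases n with
  | zero => exact MA_P h v ha
  | succ n =>
    rw [Gd_succ] at ha ⊢
    refine ⟨fun w hw => ?_, fun e => ?_⟩
    · by_cases hv : w = v
      · subst hv; rw [← mul_assoc, h.Pi]; exact ha.1 _ hw
      · rw [← mul_assoc, h.PP _ _ hv, zero_mul]; exact Submodule.zero_mem _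
    · by_cases hv : s e = v
      · subst hv; rw [← mul_assoc, h.TP]; exact ha.2 _
      · rw [← h.TP e, mul_assoc, ← mul_assoc (P (s e)), h.PP _ _ hv, zero_mul, mul_zero]
        exact Submodule.zero_mem _

theorem Gd_adjoin (h : LFam s r P S T) {x : R}
    (hx : x ∈ Algebra.adjoin K (Set.range P ∪ Set.range S ∪ Set.range T)) :
    ∃ n, x ∈ Gd K s r P T n := by
  suffices ∀ a, (∃ n, a ∈ Gd K s r P T n) → ∃ n, x * a ∈ Gd K s r P T n by
    have := this 1 ⟨0, MA_one h⟩
    simpa using this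
  induction hx using Algebra.adjoin_induction with
  | mem x hx =>
    rintro a ⟨n, ha⟩
    rcases hx with (⟨v, rfl⟩ | ⟨f, rfl⟩) | ⟨e, rfl⟩
    · exact ⟨n, Gd_P h v ha⟩
    · refine ⟨n + 1, Gd_succ.2 ⟨fun w hw => ?_, fun e => ?_⟩⟩
      · rw [← h.PS f, mul_assoc, ← mul_assoc, h.PP _ _ (hw f).symm, zero_mul]
        exact Submodule.zero_mem _
      · by_cases hef : e = f
        · subst hef
          rw [← mul_assoc, h.TS]
          exact Gd_P h _ ha
        · rw [← mul_assoc, h.TS0 _ _ hef, zero_mul]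
          exact Submodule.zero_mem _
    · exact ⟨n, (Gd_succ.1 (Gd_mono1 h ha)).2 e⟩
  | algebraMap k =>
    rintro a ⟨n, ha⟩
    refine ⟨n, ?_⟩
    rw [← Algebra.smul_def]
    exact Submodule.smul_mem _ _ ha
  | add x y _ _ hx hy =>
    intro a ha
    obtain ⟨n, hn⟩ := hx a ha
    obtain ⟨m, hm⟩ := hy a ha
    refine ⟨max n m, ?_⟩
    rw [add_mul]
    exact Submodule.add_mem _ (Gd_mono h (le_max_left _ _) hn) (Gd_mono h (le_max_right _ _) hm)
  | mul x y _ _ hx hy =>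
    intro a ha
    rw [mul_assoc]
    exact hx _ (hy a ha)

variable (K) in
def FGW (s r : E → V) (P : V → R) (T : E → R) (a : R) : Prop :=
  ∃ B : Set R, B.Finite ∧ (∀ b ∈ B, ∃ u, (Abundant s r u ∨ Tgt s r u) ∧ b ∈ MA K s r P T ∧
    P u * b = b) ∧ Submodule.span R B = Submodule.span R {a}

theorem FGW_comb {ι : Type} [Finite ι] (c : ι → R) (a : R) (hc : ∀ i, c i ∈ Submodule.span R {a})
    (ha : a ∈ Submodule.span R (Set.range c)) (hf : ∀ i, FGW K s r P T (c i)) :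
    FGW K s r P T a := by
  choose B h1 h2 h3 using hf
  refine ⟨⋃ i, B i, Set.finite_iUnion h1, ?_, ?_⟩
  · intro b hb
    obtain ⟨i, hi⟩ := Set.mem_iUnion.1 hb
    exact h2 i b hi
  · rw [Submodule.span_iUnion]
    simp only [h3]
    apply le_antisymm
    · exact iSup_le fun i => (Submodule.span_singleton_le_iff_mem _ _).2 (hc i)
    · rw [Submodule.span_singleton_le_iff_mem, ← Submodule.span_iUnion]
      convert ha using 2
      ext; simp [eq_comm]

theorem FGW_edges (h : LFam s r P S T) {v : V} (hv : ¬ Sink s v) {b : R} (hb : P v * b = b)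
    (hf : ∀ e, s e = v → FGW K s r P T (T e * b)) : FGW K s r P T b := by
  refine FGW_comb (ι := {e // s e = v}) (fun e => T e * b) b
    (fun e => Submodule.smul_mem _ _ (Submodule.mem_span_singleton_self _)) ?_
    (fun e => hf e.1 e.2)
  have h1 := (h.ck2 v).resolve_right hv
  have h2 := Submodule.mem_map_of_mem (f := LinearMap.toSpanSingleton R R b) h1
  rw [Submodule.map_span] at h2
  simp only [LinearMap.toSpanSingleton_apply, smul_eq_mul, hb] at h2
  convert h2 using 2
  ext x
  simp

theorem FGW_vertices (h : LFam s r P S T) {b : R}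
    (hf : ∀ v, FGW K s r P T (P v * b)) : FGW K s r P T b := by
  refine FGW_comb (fun v => P v * b) b
    (fun e => Submodule.smul_mem _ _ (Submodule.mem_span_singleton_self _)) ?_ hf
  have : b = ∑ v, P v * b := by rw [← Finset.sum_mul, ← h.one, one_mul]
  have h2 : ∑ v, P v * b ∈ Submodule.span R (Set.range fun v => P v * b) :=
    Submodule.sum_mem _ fun v _ => Submodule.subset_span (Set.mem_range_self v)
  rwa [← this] at h2

theorem FGW_red (h : LFam s r P S T) {v : V} (hv : Red s r v) : ∀ {b : R},
    b ∈ MA K s r P T → P v * b = b → FGW K s r P T b := by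
  induction hv with
  | ab v hv => exact fun {b} hb hp => ⟨{b}, Set.finite_singleton _,
      fun x hx => by rw [Set.mem_singleton_iff.1 hx]; exact ⟨v, Or.inl hv, hb, hp⟩, rfl⟩
  | tgt v hv => exact fun {b} hb hp => ⟨{b}, Set.finite_singleton _,
      fun x hx => by rw [Set.mem_singleton_iff.1 hx]; exact ⟨v, Or.inr hv, hb, hp⟩, rfl⟩
  | step v hv _ ih =>
    intro b hb hp
    refine FGW_edges h hv hp fun e he => ih e he (MA_T h e hb) ?_
    rw [← mul_assoc, h.PT]

theorem FGW_Gd (h : LFam s r P S T) {n : ℕ} : ∀ {a : R}, a ∈ Gd K s r P T n →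
    FGW K s r P T a := by
  have hMA : ∀ {v : V} {a : R}, P v * a ∈ MA K s r P T → FGW K s r P T (P v * a) :=
    fun {v a} ha => FGW_red h (red_all v) ha (by rw [← mul_assoc, h.Pi])
  induction n with
  | zero => exact fun {a} ha => FGW_vertices h fun v => hMA (MA_P h v ha)
  | succ n ih =>
    intro a ha
    rw [Gd_succ] at ha
    refine FGW_vertices h fun v => ?_
    by_cases hv : Sink s v
    · exact hMA (ha.1 v hv)
    · refine FGW_edges h hv (by rw [← mul_assoc, h.Pi]) fun e he => ?_
      rw [← mul_assoc, ← he, h.TP]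
      exact ih (ha.2 e)

/-- ghost paths into a non-abundant vertex -/
theorem ghost_norm (h : LFam s r P S T) {u : V} (hu : ¬ Abundant s r u) :
    ∃ C : R, P u * C = C * P u ∧ ∀ w q, IsPath s r w q u →
      ∃ k p, FV s r p u ∧ P u * Tw T q = C ^ k * (P u * Tw T p) := by
  classical
  obtain ⟨C, hC, hcl⟩ : ∃ C : R, P u * C = C * P u ∧ ∀ d, IsPath s r u d u →
      ∃ k, P u * Tw T d = C ^ k * P u := by
    by_cases hc : ∃ c, IsPath s r u c u ∧ c ≠ []
    · let f : {c // IsPath s r u c u ∧ c ≠ []} → ℕ := fun c => c.1.length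
      have : Nonempty {c // IsPath s r u c u ∧ c ≠ []} := ⟨⟨hc.choose, hc.choose_spec⟩⟩
      obtain ⟨c, ⟨hc1, hc2⟩, hmin⟩ : ∃ c, (IsPath s r u c u ∧ c ≠ []) ∧
          ∀ d, IsPath s r u d u → d ≠ [] → c.length ≤ d.length :=
        ⟨(Function.argmin f).1, (Function.argmin f).2, fun d hd hd' =>
          Function.argmin_le f ⟨d, hd, hd'⟩⟩
      have hcomm : P u * (P u * Tw T c) = P u * Tw T c * P u := by
        rw [TwP h hc1, ← mul_assoc, h.Pi]
      refine ⟨P u * Tw T c, hcomm, ?_⟩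
      have : ∀ n, ∀ d : List E, d.length ≤ n → IsPath s r u d u →
          ∃ k, P u * Tw T d = (P u * Tw T c) ^ k * P u := by
        intro n
        induction n with
        | zero =>
          intro d hd _
          have : d = [] := List.length_eq_zero_iff.1 (by omega)
          exact ⟨0, by simp [this, Tw]⟩
        | succ n ih =>
          intro d hd hp
          rcases closed_pow hu c hc1 hmin d hp with rfl | ⟨d', rfl, hd'⟩
          · exact ⟨0, by simp [Tw]⟩
          · have : 0 < c.length := List.length_pos_iff.2 hc2
            obtain ⟨k, hk⟩ := ih d' (by simp at hd; omega) hd'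
            refine ⟨k + 1, ?_⟩
            rw [Tw_append, ← mul_assoc, hk, pow_succ, mul_assoc, mul_assoc, TwP h hc1]
      exact fun d hd => this _ d le_rfl hd
    · push Not at hc
      exact ⟨0, by simp, fun d hd => ⟨0, by simp [hc d hd, Tw]⟩⟩
  refine ⟨C, hC, ?_⟩
  have : ∀ n, ∀ w (q : List E), q.length ≤ n → IsPath s r w q u →
      ∃ k p, FV s r p u ∧ P u * Tw T q = C ^ k * (P u * Tw T p) := by
    intro n
    induction n with
    | zero =>
      intro w q hq hp
      have : q = [] := List.length_eq_zero_iff.1 (by omega)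
      subst this
      exact ⟨0, [], ⟨⟨w, hp⟩, fun p' d hd _ => by simp at hd; exact hd.2⟩, by simp⟩
    | succ n ih =>
      intro w q hq hp
      by_cases hfv : FV s r q u
      · exact ⟨0, q, hfv, by simp⟩
      · obtain ⟨p', d, hqd, hd, hne⟩ : ∃ p' d, q = p' ++ d ∧ IsPath s r u d u ∧ d ≠ [] := by
          by_contra hcon
          push Not at hcon
          exact hfv ⟨⟨w, hp⟩, hcon⟩
        subst hqd
        obtain ⟨x, hx1, hx2⟩ := hp.split
        have hxu : x = u := by
          cases d with
          | nil => exact absurd rfl hne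
          | cons e d => exact hx2.1.symm.trans hd.1
        subst hxu
        have : 0 < d.length := List.length_pos_iff.2 hne
        obtain ⟨k, p, hfp, hk⟩ := ih w p' (by simp at hq; omega) hx1
        obtain ⟨j, hj⟩ := hcl d hd
        refine ⟨j + k, p, hfp, ?_⟩
        rw [Tw_append, ← mul_assoc, hj, mul_assoc, hk, pow_add, mul_assoc]
  exact fun w q hq => this _ w q le_rfl hq

theorem tgt_reduce (h : LFam s r P S T) {u : V} (hu : Tgt s r u) (B : Set R) (hB : B.Finite)
    (hBA : ∀ b ∈ B, b ∈ MA K s r P T ∧ P u * b = b) :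
    ∃ (F : Finset (List E)) (b : List E → R), (∀ p ∈ F, FV s r p u ∧ P u * b p = b p) ∧
      Submodule.span R (b '' F) = Submodule.span R B := by
  classical
  obtain ⟨C, hC, hn⟩ := ghost_norm h hu.1
  let φ : Polynomial K →ₐ[K] R := Polynomial.aeval C
  let _ : Module (Polynomial K) R := Module.compHom R φ.toRingHom
  have hsm : ∀ (f : Polynomial K) (x : R), f • x = φ f * x := fun f x => rfl
  have hPφ : ∀ f, P u * φ f = φ f * P u := by
    intro f
    induction f using Polynomial.induction_on' with
    | add f g hf hg => simp only [map_add, mul_add, add_mul, hf, hg]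
    | monomial n a =>
      simp only [φ, Polynomial.aeval_monomial]
      have : Commute (P u) (algebraMap K R a * C ^ n) :=
        Commute.mul_right (Algebra.commutes a (P u)).symm (Commute.pow_right hC n)
      exact this
  let N : Submodule (Polynomial K) R :=
    Submodule.span (Polynomial K) (Set.range fun p : {p // FV s r p u} => P u * Tw T p.1)
  have hK : ∀ (k : K) (x : R), x ∈ N → k • x ∈ N := by
    intro k x hx
    have : k • x = (Polynomial.C k) • x := by
      rw [hsm]; simp [φ, Algebra.smul_def]
    rw [this]
    exact Submodule.smul_mem _ _ hx
  have hMA : ∀ a ∈ MA K s r P T, P u * a ∈ N := by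
    intro a ha
    unfold MA at ha
    induction ha using Submodule.span_induction with
    | mem x hx =>
      obtain ⟨w, q, v, hq, rfl⟩ := hx
      by_cases hv : u = v
      · subst hv
        rw [← mul_assoc, h.Pi]
        obtain ⟨k, p, hp, hk⟩ := hn w q hq
        have : P u * Tw T q = (Polynomial.X ^ k : Polynomial K) • (P u * Tw T p) := by
          rw [hsm, hk]; simp [φ]
        rw [this]
        exact Submodule.smul_mem _ _ (Submodule.subset_span ⟨⟨p, hp⟩, rfl⟩)
      · rw [← mul_assoc, h.PP _ _ hv, zero_mul]; exact N.zero_mem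
    | zero => simp
    | add x y _ _ hx hy => rw [mul_add]; exact N.add_mem hx hy
    | smul k x _ hx => rw [mul_smul_comm]; exact hK k _ hx
  obtain ⟨F, b, hb⟩ := pid_lemma (D := Polynomial K)
    (fun p : {p // FV s r p u} => P u * Tw T p.1) B hB (fun x hx => by
      have := hMA x (hBA x hx).1
      rwa [(hBA x hx).2] at this)
  have hle : ∀ (X : Set R) (x : R), x ∈ Submodule.span (Polynomial K) X →
      x ∈ Submodule.span R X := by
    intro X x hx
    induction hx using Submodule.span_induction with
    | mem x hx => exact Submodule.subset_span hx
    | zero => exact Submodule.zero_mem _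
    | add x y _ _ hx hy => exact Submodule.add_mem _ hx hy
    | smul k x _ hx => rw [hsm]; exact Submodule.smul_mem _ _ hx
  have hfix : ∀ x, x ∈ Submodule.span (Polynomial K) B → P u * x = x := by
    intro x hx
    induction hx using Submodule.span_induction with
    | mem x hx => exact (hBA x hx).2
    | zero => simp
    | add x y _ _ hx hy => rw [mul_add, hx, hy]
    | smul k x _ hx => rw [hsm, ← mul_assoc, hPφ, mul_assoc, hx]
  let b' : List E → R := fun p => if hp : FV s r p u then b ⟨p, hp⟩ else 0
  have himg : b' '' (F.map (Function.Embedding.subtype _) : Finset (List E)) = b '' F := by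
    ext x
    constructor
    · rintro ⟨p, hp, rfl⟩
      simp only [Finset.coe_map, Set.mem_image] at hp
      obtain ⟨q, hq, rfl⟩ := hp
      exact ⟨q, hq, by simp [b', q.2]⟩
    · rintro ⟨q, hq, rfl⟩
      exact ⟨q.1, by simpa using ⟨q.2, hq⟩, by simp [b', q.2]⟩
  refine ⟨F.map (Function.Embedding.subtype _), b', ?_, ?_⟩
  · intro p hp
    obtain ⟨q, hq, rfl⟩ := Finset.mem_map.1 hp
    refine ⟨q.2, hfix _ ?_⟩
    rw [← hb]
    exact Submodule.subset_span ⟨q, hq, by simp [b', q.2]⟩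
  · rw [himg]
    apply le_antisymm
    · rw [Submodule.span_le]
      intro x hx
      exact hle _ _ (hb ▸ Submodule.subset_span hx)
    · rw [Submodule.span_le]
      intro x hx
      refine hle _ _ ?_
      rw [hb]
      exact Submodule.subset_span hx

theorem tgt_all (h : LFam s r P S T) (B : Set R) (hB : B.Finite)
    (hBA : ∀ b ∈ B, ∃ u, Tgt s r u ∧ b ∈ MA K s r P T ∧ P u * b = b) :
    ∃ x, Submodule.span R {x} = Submodule.span R B := by
  classical
  let Bu : {u // Tgt s r u} → Set R := fun u => {b ∈ B | P u.1 * b = b}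
  have hBu : ∀ u : {u // Tgt s r u}, ∃ (F : Finset (List E)) (b : List E → R),
      (∀ p ∈ F, FV s r p u.1 ∧ P u.1 * b p = b p) ∧
      Submodule.span R (b '' F) = Submodule.span R (Bu u) := by
    intro u
    refine tgt_reduce (K := K) h u.2 (Bu u) (hB.subset fun x hx => hx.1) ?_
    intro b hb
    obtain ⟨_, _, h2, _⟩ := hBA b hb.1
    exact ⟨h2, hb.2⟩
  choose F b h1 h2 using hBu
  let b' : V × List E → R := fun i => if hi : Tgt s r i.1 then b ⟨i.1, hi⟩ i.2 else 0
  let F' : Finset (V × List E) := Finset.univ.biUnion fun u : {u // Tgt s r u} =>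
    (F u).image fun p => (u.1, p)
  have hmem : ∀ i, i ∈ F' ↔ ∃ u : {u // Tgt s r u}, ∃ p ∈ F u, (u.1, p) = i := by
    intro i; simp [F']
  have hb' : ∀ (u : {u // Tgt s r u}) p, b' (u.1, p) = b u p := by
    intro u p; simp [b', u.2]
  obtain ⟨x, hx⟩ := combine h F' (by
      intro i hi
      obtain ⟨u, p, hp, rfl⟩ := (hmem i).1 hi
      exact ⟨u.2, (h1 u p hp).1⟩) b' (by
      intro i hi
      obtain ⟨u, p, hp, rfl⟩ := (hmem i).1 hi
      rw [hb']
      exact (h1 u p hp).2)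
  refine ⟨x, hx.trans (le_antisymm ?_ ?_)⟩
  · rw [Submodule.span_le]
    rintro _ ⟨i, hi, rfl⟩
    obtain ⟨u, p, hp, rfl⟩ := (hmem i).1 hi
    rw [hb']
    have : b u p ∈ Submodule.span R (Bu u) := by
      rw [← h2 u]; exact Submodule.subset_span ⟨p, hp, rfl⟩
    exact Submodule.span_mono (fun x hx => hx.1) this
  · rw [Submodule.span_le]
    intro y hy
    obtain ⟨u, hu, _, h4⟩ := hBA y hy
    have : y ∈ Submodule.span R (Bu ⟨u, hu⟩) := Submodule.subset_span ⟨hy, h4⟩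
    rw [← h2] at this
    refine Submodule.span_mono ?_ this
    rintro _ ⟨p, hp, rfl⟩
    exact ⟨(u, p), (hmem _).2 ⟨⟨u, hu⟩, p, hp, rfl⟩, hb' ⟨u, hu⟩ p⟩

theorem abundant_all (h : LFam s r P S T) (B : Set R) (hB : B.Finite) (z : R)
    (hBA : ∀ b ∈ B, ∃ u, Abundant s r u ∧ P u * b = b) :
    ∃ x, Submodule.span R {x} = Submodule.span R ({z} ∪ B) := by
  induction B, hB using Set.Finite.induction_on with
  | empty => exact ⟨z, by simp⟩
  | @insert a B _ _ ih =>
    obtain ⟨x, hx⟩ := ih fun b hb => hBA b (Set.mem_insert_of_mem _ hb)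
    obtain ⟨u, hu, hp⟩ := hBA a (Set.mem_insert _ _)
    obtain ⟨y, hy⟩ := absorb h hu x a hp
    refine ⟨y, ?_⟩
    rw [hy, Submodule.span_insert, hx, ← Submodule.span_union]
    congr 1
    ext t; simp

theorem bezout_fin (h : LFam s r P S T) (A : Set R) (hA : A.Finite)
    (hAg : ∀ a ∈ A, a ∈ Algebra.adjoin K (Set.range P ∪ Set.range S ∪ Set.range T)) :
    ∃ x, Submodule.span R {x} = Submodule.span R A := by
  have h1 : ∀ a : A, FGW K s r P T a.1 := fun a => by
    obtain ⟨n, hn⟩ := Gd_adjoin h (hAg a.1 a.2)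
    exact FGW_Gd h hn
  choose B hB1 hB2 hB3 using h1
  have := hA.to_subtype
  let C := ⋃ a, B a
  have hC : C.Finite := Set.finite_iUnion hB1
  have hspan : Submodule.span R C = Submodule.span R A := by
    simp only [C]
    rw [Submodule.span_iUnion]
    simp only [hB3]
    rw [← Submodule.span_iUnion]
    congr 1
    ext; simp
  have hCW : ∀ b ∈ C, ∃ u, (Abundant s r u ∨ Tgt s r u) ∧ b ∈ MA K s r P T ∧ P u * b = b := by
    intro b hb
    obtain ⟨i, hi⟩ := Set.mem_iUnion.1 hb
    exact hB2 i b hi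
  let C1 := {b ∈ C | ∃ u, Abundant s r u ∧ P u * b = b}
  let C2 := {b ∈ C | ∃ u, Tgt s r u ∧ b ∈ MA K s r P T ∧ P u * b = b}
  have hC12 : C2 ∪ C1 = C := by
    ext b
    constructor
    · rintro (hb | hb) <;> exact hb.1
    · intro hb
      obtain ⟨u, hu | hu, h1, h2⟩ := hCW b hb
      · exact Or.inr ⟨hb, u, hu, h2⟩
      · exact Or.inl ⟨hb, u, hu, h1, h2⟩
  obtain ⟨z, hz⟩ := tgt_all (K := K) h C2 (hC.subset fun x hx => hx.1) (fun b hb => hb.2)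
  obtain ⟨x, hx⟩ := abundant_all h C1 (hC.subset fun x hx => hx.1) z (fun b hb => hb.2)
  refine ⟨x, ?_⟩
  rw [hx, Submodule.span_union, hz, ← Submodule.span_union, hC12, hspan]

end fam


theorem cohn_bezout {K R V E : Type} [Field K] [Ring R] [Algebra K R] [Fintype V]
    (s r : E → V) (P : V → R) (S T : E → R)
    (PP : ∀ v w, v ≠ w → P v * P w = 0)
    (Pi : ∀ v, P v * P v = P v)
    (PS : ∀ e, P (s e) * S e = S e)
    (SP : ∀ e, S e * P (r e) = S e)
    (PT : ∀ e, P (r e) * T e = T e)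
    (TP : ∀ e, T e * P (s e) = T e)
    (TS0 : ∀ e f, e ≠ f → T e * S f = 0)
    (TS : ∀ e, T e * S e = P (r e))
    (one : 1 = ∑ v, P v)
    (F : Finset E) (A : Set R) (hA : A.Finite)
    (hAg : ∀ a ∈ A, a ∈ Algebra.adjoin K (Set.range P ∪ S '' F ∪ T '' F)) :
    ∃ x, Submodule.span R {x} = Submodule.span R A := by
  classical
  let Q : V → R := fun v => ∑ e ∈ F with s e = v, S e * T e
  let P' : V × Bool → R := fun i => if i.2 then P i.1 - Q i.1 else Q i.1
  let s' : F × Bool → V × Bool := fun e => (s e.1, false)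
  let r' : F × Bool → V × Bool := fun e => (r e.1, e.2)
  let S' : F × Bool → R := fun e => S e.1 * P' (r' e)
  let T' : F × Bool → R := fun e => P' (r' e) * T e.1
  have PS0 : ∀ v e, v ≠ s e → P v * S e = 0 := by
    intro v e hv
    rw [← PS e, ← mul_assoc, PP _ _ hv, zero_mul]
  have TP0 : ∀ v e, s e ≠ v → T e * P v = 0 := by
    intro v e hv
    rw [← TP e, mul_assoc, PP _ _ hv, mul_zero]
  have PQ : ∀ v, P v * Q v = Q v := by
    intro v
    simp only [Q, Finset.mul_sum]
    refine Finset.sum_congr rfl fun e he => ?_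
    rw [← (Finset.mem_filter.1 he).2, ← mul_assoc, PS]
  have QP : ∀ v, Q v * P v = Q v := by
    intro v
    simp only [Q, Finset.sum_mul]
    refine Finset.sum_congr rfl fun e he => ?_
    rw [← (Finset.mem_filter.1 he).2, mul_assoc, TP]
  have QS : ∀ e ∈ F, Q (s e) * S e = S e := by
    intro e he
    simp only [Q, Finset.sum_mul]
    rw [Finset.sum_eq_single e]
    · rw [mul_assoc, TS, SP]
    · intro f _ hfe
      rw [mul_assoc, TS0 _ _ hfe, mul_zero]
    · intro hn; exact absurd (by simp [he]) hn
  have TQ : ∀ e ∈ F, T e * Q (s e) = T e := by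
    intro e he
    simp only [Q, Finset.mul_sum]
    rw [Finset.sum_eq_single e]
    · rw [← mul_assoc, TS, PT]
    · intro f _ hfe
      rw [← mul_assoc, TS0 _ _ hfe.symm, zero_mul]
    · intro hn; exact absurd (by simp [he]) hn
  have QQ : ∀ v, Q v * Q v = Q v := by
    intro v
    conv_lhs => rw [show Q v = ∑ e ∈ F with s e = v, S e * T e from rfl]
    rw [Finset.sum_mul]
    refine Finset.sum_congr rfl fun e he => ?_
    obtain ⟨h1, h2⟩ := Finset.mem_filter.1 he
    have := TQ e h1
    rw [h2] at this
    rw [mul_assoc, this]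
  have P'l : ∀ v i, P v * P' (v, i) = P' (v, i) := by
    intro v i
    cases i <;> simp [P', PQ, mul_sub, Pi]
  have P'r : ∀ v i, P' (v, i) * P v = P' (v, i) := by
    intro v i
    cases i <;> simp [P', QP, sub_mul, Pi]
  have P'i : ∀ v, P' v * P' v = P' v := by
    rintro ⟨v, i⟩
    cases i <;> simp [P', QQ, sub_mul, mul_sub, Pi, PQ, QP]
  have P'0 : ∀ v w, v ≠ w → P' v * P' w = 0 := by
    rintro ⟨v, i⟩ ⟨w, j⟩ hvw
    by_cases h : v = w
    · subst h
      cases i <;> cases j <;> simp_all [P', sub_mul, mul_sub]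
    · rw [← P'r, ← P'l w, mul_assoc, ← mul_assoc (P v), PP _ _ h, zero_mul, mul_zero]
  have P's : ∀ v, P' (v, false) + P' (v, true) = P v := by
    intro v; simp [P']
  have fam : LFam s' r' P' S' T' :=
    { PP := P'0
      Pi := P'i
      PS := by
        rintro ⟨e, i⟩
        simp only [s', S']
        rw [← mul_assoc]
        simp only [P', Bool.false_eq_true, if_false, QS e.1 e.2]
      SP := by
        rintro ⟨e, i⟩
        simp only [S', mul_assoc, P'i]
      PT := by
        rintro ⟨e, i⟩
        simp only [T', ← mul_assoc, P'i]
      TP := by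
        rintro ⟨e, i⟩
        simp only [s', T']
        rw [mul_assoc]
        simp only [P', Bool.false_eq_true, if_false, TQ e.1 e.2]
      TS0 := by
        rintro ⟨e, i⟩ ⟨f, j⟩ hef
        simp only [S', T']
        by_cases h : e = f
        · subst h
          have hij : r' (e, i) ≠ r' (e, j) := by
            intro hh
            simp only [r', Prod.mk.injEq] at hh
            exact hef (by rw [hh.2])
          rw [mul_assoc, ← mul_assoc (T e), TS]
          simp only [r'] at hij ⊢
          rw [P'l, P'0 _ _ hij]
        · rw [mul_assoc, ← mul_assoc (T e), TS0 _ _ (fun hh => h (Subtype.ext hh)), zero_mul,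
            mul_zero]
      TS := by
        rintro ⟨e, i⟩
        simp only [S', T']
        rw [mul_assoc, ← mul_assoc (T e), TS]
        simp only [r']
        rw [P'l, P'i]
      ck2 := by
        rintro ⟨v, i⟩
        cases i with
        | true => right; intro e; simp [s']
        | false =>
          left
          simp only [P', Bool.false_eq_true, if_false, Q]
          refine Submodule.sum_mem _ fun e he => ?_
          obtain ⟨h1, h2⟩ := Finset.mem_filter.1 he
          have : T e = T' (⟨e, h1⟩, false) + T' (⟨e, h1⟩, true) := by
            simp only [T', r']
            rw [← add_mul, P's, PT]
          rw [this]
          refine Submodule.smul_mem _ _ (Submodule.add_mem _ ?_ ?_)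
          · exact Submodule.subset_span ⟨_, by simp [s', h2], rfl⟩
          · exact Submodule.subset_span ⟨_, by simp [s', h2], rfl⟩
      one := by
        rw [one, Fintype.sum_prod_type]
        refine Finset.sum_congr rfl fun v _ => ?_
        simp [← P's v, add_comm] }
  refine bezout_fin (K := K) fam A hA fun a ha => ?_
  refine (Algebra.adjoin_le ?_ : Algebra.adjoin K _ ≤ _) (hAg a ha)
  rintro x ((⟨v, rfl⟩ | ⟨e, he, rfl⟩) | ⟨e, he, rfl⟩)
  · rw [← P's]
    exact Subalgebra.add_mem _ (Algebra.subset_adjoin (Or.inl (Or.inl ⟨_, rfl⟩)))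
      (Algebra.subset_adjoin (Or.inl (Or.inl ⟨_, rfl⟩)))
  · have : S e = S' (⟨e, he⟩, false) + S' (⟨e, he⟩, true) := by
      simp only [S', r']
      rw [← mul_add, P's, SP]
    rw [this]
    exact Subalgebra.add_mem _ (Algebra.subset_adjoin (Or.inl (Or.inr ⟨_, rfl⟩)))
      (Algebra.subset_adjoin (Or.inl (Or.inr ⟨_, rfl⟩)))
  · have : T e = T' (⟨e, he⟩, false) + T' (⟨e, he⟩, true) := by
      simp only [T', r']
      rw [← add_mul, P's, PT]
    rw [this]
    exact Subalgebra.add_mem _ (Algebra.subset_adjoin (Or.inr ⟨_, rfl⟩))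
      (Algebra.subset_adjoin (Or.inr ⟨_, rfl⟩))

end LPAB

/-- For a directed graph `E` with finitely many vertices and a field `K`,
the Leavitt path algebra `L = L_K(E)` is a Bézout ring: every finitely generated left
ideal of `L` is principal, i.e. of the form `L a = span {a}` for some `a ∈ L`. -/
theorem lpa_Bezout (K V E : Type) [Field K] [Fintype V] (s r : E → V) :
    ∀ I : Submodule (LeavittPathAlgebra K V E s r) (LeavittPathAlgebra K V E s r),
      I.FG → ∃ a : LeavittPathAlgebra K V E s r,
        I = Submodule.span (LeavittPathAlgebra K V E s r) {a} := by
  classical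
  intro I hI
  let π : FreeAlgebra K (LPAGen V E) →ₐ[K] LeavittPathAlgebra K V E s r :=
    RingQuot.mkAlgHom K (LPARel K V E s r)
  have hrel : ∀ {x y}, LPARel K V E s r x y → π x = π y :=
    fun h => RingQuot.mkAlgHom_rel K h
  let P : V → LeavittPathAlgebra K V E s r := fun v => π (FreeAlgebra.ι K (LPAGen.vertex v))
  let S : E → LeavittPathAlgebra K V E s r := fun e => π (FreeAlgebra.ι K (LPAGen.edge e))
  let T : E → LeavittPathAlgebra K V E s r := fun e => π (FreeAlgebra.ι K (LPAGen.ghost e))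
  let X : Finset E → Subalgebra K (LeavittPathAlgebra K V E s r) := fun F =>
    Algebra.adjoin K (Set.range P ∪ S '' F ∪ T '' F)
  have hX : ∀ {F G : Finset E}, F ⊆ G → X F ≤ X G := by
    intro F G h
    refine Algebra.adjoin_mono ?_
    have h' : (F : Set E) ⊆ G := by exact_mod_cast h
    exact Set.union_subset_union (Set.union_subset_union_right _ (Set.image_mono h'))
      (Set.image_mono h')
  have hmem : ∀ a : LeavittPathAlgebra K V E s r, ∃ F, a ∈ X F := by
    intro a
    obtain ⟨x, rfl⟩ := RingQuot.mkAlgHom_surjective K (LPARel K V E s r) a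
    change ∃ F, π x ∈ X F
    induction x using FreeAlgebra.induction with
    | grade0 k => exact ⟨∅, by rw [AlgHom.commutes]; exact Subalgebra.algebraMap_mem _ _⟩
    | grade1 g =>
      cases g with
      | vertex v => exact ⟨∅, Algebra.subset_adjoin (Or.inl (Or.inl ⟨v, rfl⟩))⟩
      | edge e => exact ⟨{e}, Algebra.subset_adjoin (Or.inl (Or.inr ⟨e, by simp, rfl⟩))⟩
      | ghost e => exact ⟨{e}, Algebra.subset_adjoin (Or.inr ⟨e, by simp, rfl⟩)⟩
    | mul x y hx hy =>
      obtain ⟨F, hF⟩ := hx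
      obtain ⟨G, hG⟩ := hy
      refine ⟨F ∪ G, ?_⟩
      rw [map_mul]
      exact Subalgebra.mul_mem _ (hX Finset.subset_union_left hF) (hX Finset.subset_union_right hG)
    | add x y hx hy =>
      obtain ⟨F, hF⟩ := hx
      obtain ⟨G, hG⟩ := hy
      refine ⟨F ∪ G, ?_⟩
      rw [map_add]
      exact Subalgebra.add_mem _ (hX Finset.subset_union_left hF) (hX Finset.subset_union_right hG)
  choose Fa hFa using hmem
  obtain ⟨A, hA⟩ := hI
  obtain ⟨x, hx⟩ := LPAB.cohn_bezout (K := K) s r P S T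
    (fun v w h => by simpa [P] using hrel (LPARel.vertex_orth v w h))
    (fun v => by simpa [P] using hrel (LPARel.vertex_idem v))
    (fun e => by simpa [P, S] using hrel (LPARel.edge_src e))
    (fun e => by simpa [P, S] using hrel (LPARel.edge_rng e))
    (fun e => by simpa [P, T] using hrel (LPARel.ghost_rng e))
    (fun e => by simpa [P, T] using hrel (LPARel.ghost_src e))
    (fun e f h => by simpa [S, T] using hrel (LPARel.ck1_distinct e f h))
    (fun e => by simpa [P, S, T] using hrel (LPARel.ck1_same e))
    (by simpa [P] using hrel (LPARel.unit (K := K) (s := s) (r := r)))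
    (A.biUnion Fa) (A : Set _) A.finite_toSet
    (fun a ha => hX (Finset.subset_biUnion_of_mem Fa (by simpa using ha)) (hFa a))
  exact ⟨x, by rw [hx, hA]⟩
end

section
/- Let E be a directed graph with E⁰ finite and K a field, and let L = L_K(E) be the (unital) Leavitt path algebra. Then both the sum and the intersection of any two principal left ideals of L are again principal left ideals; hence the principal left ideals of L form a sublattice of the lattice of all left ideals of L. -/
namespace LPAProof

set_option linter.unusedSectionVars false

open Classical in
/-- a compatible well-order on words -/
theorem exists_word_order (V E : Type) :
    ∃ lt : V × List E → V × List E → Prop, IsWellOrder _ lt ∧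
      ∀ u l u' l' m, lt (u, l) (u', l') → lt (u, l ++ m) (u', l' ++ m) := by
  have lexapp : ∀ (l l' m : List E), l.length = l'.length →
      List.Lex WellOrderingRel l l' → List.Lex WellOrderingRel (l ++ m) (l' ++ m) := by
    intro l l' m hl h
    induction h with
    | nil => simp at hl
    | cons _ ih => exact List.Lex.cons (ih (by simpa using hl))
    | rel h => exact List.Lex.rel h
  refine ⟨Prod.Lex WellOrderingRel (List.Shortlex WellOrderingRel), ?_, ?_⟩
  · have htri : Std.Trichotomous (List.Shortlex (WellOrderingRel (α := E))) := inferInstance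
    have : IsWellOrder (List E) (List.Shortlex WellOrderingRel) :=
      { wf := List.Shortlex.wf WellOrderingRel.isWellOrder.wf
        trichotomous := htri.trichotomous }
    infer_instance
  · intro u l u' l' m h
    rw [Prod.lex_def] at h ⊢
    rcases h with h | ⟨h1, h2⟩
    · exact Or.inl h
    · refine Or.inr ⟨h1, ?_⟩
      rw [List.shortlex_def] at h2 ⊢
      rcases h2 with h2 | ⟨h2, h3⟩
      · left; simpa using h2
      · right
        exact ⟨by simpa using h2, lexapp _ _ _ h2 h3⟩

section defs
variable {V E : Type} (s r : E → V)

/-- end vertex of the word `l` starting at `u` -/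
def tgt : V → List E → V
  | u, [] => u
  | _, e :: l => tgt (r e) l

/-- `l` is a path starting at `u` -/
def Vd : V → List E → Prop
  | _, [] => True
  | u, e :: l => s e = u ∧ Vd (r e) l

theorem tgt_append (u : V) (l m : List E) : tgt r u (l ++ m) = tgt r (tgt r u l) m := by
  induction l generalizing u with
  | nil => rfl
  | cons e l ih => exact ih _

theorem Vd_append (u : V) (l m : List E) :
    Vd s r u (l ++ m) ↔ Vd s r u l ∧ Vd s r (tgt r u l) m := by
  induction l generalizing u with
  | nil => simp [Vd, tgt]
  | cons e l ih => simp [Vd, tgt, ih, and_assoc]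

/-- product of ghost edges along a path -/
def ghp {L : Type} [Ring L] (gs : E → L) : List E → L
  | [] => 1
  | e :: l => ghp gs l * gs e

/-- product of edges along a path -/
def edp {L : Type} [Ring L] (eg : E → L) : List E → L
  | [] => 1
  | e :: l => eg e * edp eg l

/-- ghost monomial -/
def mono {L : Type} [Ring L] (vx : V → L) (gs : E → L) (w : V × List E) : L :=
  ghp gs w.2 * vx w.1

/-- evaluation of formal ghost polynomials -/
noncomputable def evl (K : Type) [Field K] {L : Type} [Ring L] [Algebra K L]
    (vx : V → L) (gs : E → L) : ((V × List E) →₀ K) →ₗ[K] L :=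
  Finsupp.linearCombination K (mono vx gs)

end defs

/-- What we use about the Leavitt path algebra. -/
structure LDat (K V E L : Type) [Field K] [Fintype V] [Ring L] [Algebra K L] (s r : E → V) where
  vx : V → L
  eg : E → L
  gs : E → L
  vx_orth : ∀ v w, v ≠ w → vx v * vx w = 0
  vx_idem : ∀ v, vx v * vx v = vx v
  src_eg : ∀ e, vx (s e) * eg e = eg e
  eg_rng : ∀ e, eg e * vx (r e) = eg e
  rng_gs : ∀ e, vx (r e) * gs e = gs e
  gs_src : ∀ e, gs e * vx (s e) = gs e
  ck1_ne : ∀ e f, e ≠ f → gs e * eg f = 0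
  ck1 : ∀ e, gs e * eg e = vx (r e)
  ck2 : ∀ v (F : Finset E), (∀ e, e ∈ F ↔ s e = v) → F.Nonempty →
    vx v = ∑ e ∈ F, eg e * gs e
  one_eq : (1 : L) = ∑ v, vx v
  ind : ∀ U : Submodule K L, (1 : L) ∈ U → (∀ v, ∀ x ∈ U, vx v * x ∈ U) →
    (∀ e, ∀ x ∈ U, eg e * x ∈ U) → (∀ e, ∀ x ∈ U, gs e * x ∈ U) → ∀ x, x ∈ U
  indep : ∀ Γ : (V × List E) →₀ K, (∀ w, Γ w ≠ 0 → Vd s r w.1 w.2) →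
    evl K vx gs Γ = 0 → Γ = 0

namespace LDat
open Classical

variable {K V E L : Type} [Field K] [Fintype V] [Ring L] [Algebra K L] {s r : E → V}
  (D : LDat K V E L s r)

/-- formal evaluation -/
noncomputable def ev : ((V × List E) →₀ K) →ₗ[K] L := evl K D.vx D.gs

/-- ghost path -/
def gh (l : List E) : L := ghp D.gs l

/-- real path -/
def ed (l : List E) : L := edp D.eg l

/-- ghost monomial -/
def mo (w : V × List E) : L := D.gh w.2 * D.vx w.1

/-- complement idempotent -/
noncomputable def hh (F : Finset E) : L := 1 - ∑ e ∈ F, D.eg e * D.gs e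

/-- span of the monomials in `S` -/
def Gs (S : Set (V × List E)) : Submodule K L := Submodule.span K (D.mo '' S)

@[simp] theorem gh_nil : D.gh [] = 1 := rfl
@[simp] theorem ed_nil : D.ed [] = 1 := rfl
theorem gh_cons (e l) : D.gh (e :: l) = D.gh l * D.gs e := rfl
theorem ed_cons (e l) : D.ed (e :: l) = D.eg e * D.ed l := rfl

theorem gh_append (l m : List E) : D.gh (l ++ m) = D.gh m * D.gh l := by
  induction l with
  | nil => simp
  | cons e l ih => rw [List.cons_append, gh_cons, gh_cons, ih, mul_assoc]

theorem ed_append (l m : List E) : D.ed (l ++ m) = D.ed l * D.ed m := by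
  induction l with
  | nil => simp
  | cons e l ih => rw [List.cons_append, ed_cons, ed_cons, ih, mul_assoc]

theorem vx_mul (v w : V) : D.vx v * D.vx w = if v = w then D.vx v else 0 := by
  split_ifs with h
  · rw [h, D.vx_idem]
  · exact D.vx_orth _ _ h

theorem vx_mul_eg (v : V) (e : E) : D.vx v * D.eg e = if v = s e then D.eg e else 0 := by
  rw [← D.src_eg, ← mul_assoc, vx_mul]
  split_ifs with h
  · rw [h]
  · simp

theorem vx_mul_gs (v : V) (e : E) : D.vx v * D.gs e = if v = r e then D.gs e else 0 := by
  rw [← D.rng_gs, ← mul_assoc, vx_mul]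
  split_ifs with h
  · rw [h]
  · simp

theorem gs_mul_vx (v : V) (e : E) : D.gs e * D.vx v = if s e = v then D.gs e else 0 := by
  rw [← D.gs_src, mul_assoc, vx_mul]
  split_ifs with h <;> simp

theorem gs_mul_eg (e f : E) : D.gs e * D.eg f = if e = f then D.vx (r e) else 0 := by
  split_ifs with h
  · rw [← h, D.ck1]
  · exact D.ck1_ne _ _ h

/-- monomials of paths have a left vertex -/
theorem vx_mul_mo {w : V × List E} (hw : Vd s r w.1 w.2) (v : V) :
    D.vx v * D.mo w = if v = tgt r w.1 w.2 then D.mo w else 0 := by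
  obtain ⟨u, l⟩ := w
  simp only [mo] at *
  induction l generalizing u with
  | nil =>
    simp only [tgt, vx_mul, gh_nil, one_mul]
    split_ifs with h
    · rw [h]
    · rfl
  | cons e l ih =>
    have := ih (r e) hw.2
    have h2 : D.gh (e :: l) * D.vx u = D.gh l * D.vx (r e) * (D.gs e * D.vx u) := by
      rw [gh_cons, ← D.rng_gs]
      simp only [mul_assoc]
      rw [← mul_assoc (D.vx (r e)) (D.vx (r e)), D.vx_idem]
    rw [h2, tgt, ← mul_assoc, this]
    split_ifs <;> simp

theorem gh_vx_ed {u : V} {l : List E} (h : Vd s r u l) :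
    D.gh l * D.vx u * D.ed l = D.vx (tgt r u l) := by
  induction l generalizing u with
  | nil => simp [tgt]
  | cons e l ih =>
    obtain ⟨rfl, h2⟩ := h
    rw [gh_cons, ed_cons, mul_assoc (D.gh l), D.gs_src, mul_assoc, ← mul_assoc (D.gs e), D.ck1,
      ← mul_assoc, ih h2, tgt]

theorem ed_vx {u : V} {l : List E} (h : Vd s r u l) :
    D.vx u * D.ed l * D.vx (tgt r u l) = D.vx u * D.ed l := by
  induction l generalizing u with
  | nil => simp [tgt, D.vx_idem]
  | cons e l ih =>
    obtain ⟨rfl, h2⟩ := h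
    have := ih h2
    rw [ed_cons, ← mul_assoc, D.src_eg, tgt, ← D.eg_rng, mul_assoc, mul_assoc, ← mul_assoc _ _
      (D.vx (tgt _ _ _)), this, mul_assoc]

theorem gh_vx_ed_zero (u : V) (l m : List E) (h1 : ¬ l <+: m) (h2 : ¬ m <+: l) :
    D.gh l * D.vx u * D.ed m = 0 := by
  induction l generalizing u m with
  | nil => simp at h1
  | cons e l ih =>
    cases m with
    | nil => simp at h2
    | cons f m =>
      rw [gh_cons, ed_cons, mul_assoc (D.gh l), D.gs_mul_vx]
      split_ifs with h
      · rw [mul_assoc, ← mul_assoc (D.gs e), D.gs_mul_eg]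
        split_ifs with hf
        · subst hf
          rw [← mul_assoc]
          exact ih _ _ (by simpa [List.cons_prefix_cons] using h1)
            (by simpa [List.cons_prefix_cons] using h2)
        · simp
      · simp

theorem hh_mul_eg {F : Finset E} {e : E} (he : e ∈ F) : D.hh F * D.eg e = 0 := by
  rw [hh, sub_mul, Finset.sum_mul, Finset.sum_eq_single e]
  · rw [mul_assoc, D.ck1, D.eg_rng, one_mul, sub_self]
  · intro b _ hb
    rw [mul_assoc, D.ck1_ne _ _ hb, mul_zero]
  · exact fun h => absurd he h

theorem gs_mul_hh (F : Finset E) (e : E) :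
    D.gs e * D.hh F = if e ∈ F then 0 else D.gs e := by
  rw [hh, mul_sub, Finset.mul_sum, mul_one]
  split_ifs with he
  · rw [Finset.sum_eq_single e]
    · rw [← mul_assoc, D.ck1, D.rng_gs, sub_self]
    · intro b _ hb
      rw [← mul_assoc, D.ck1_ne _ _ hb.symm, zero_mul]
    · exact fun h => absurd he h
  · rw [Finset.sum_eq_zero, sub_zero]
    intro b hb
    rw [← mul_assoc, D.ck1_ne e b (fun h => he (h ▸ hb)), zero_mul]

theorem hh_idem (F : Finset E) : D.hh F * D.hh F = D.hh F := by
  conv_lhs => arg 2; rw [hh]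
  rw [mul_sub, Finset.mul_sum, mul_one, Finset.sum_eq_zero, sub_zero]
  intro e he
  rw [← mul_assoc, D.hh_mul_eg he, zero_mul]

theorem vx_hh (F : Finset E) (v : V) :
    D.vx v * D.hh F = D.vx v - ∑ e ∈ F with s e = v, D.eg e * D.gs e := by
  rw [hh, mul_sub, mul_one, Finset.mul_sum, Finset.sum_filter]
  congr 1
  refine Finset.sum_congr rfl fun e _ => ?_
  rw [← mul_assoc, D.vx_mul_eg]
  by_cases h : s e = v
  · simp [h]
  · simp [h, Ne.symm h]

theorem hh_vx (F : Finset E) (v : V) : D.hh F * D.vx v = D.vx v * D.hh F := by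
  rw [vx_hh, hh, sub_mul, one_mul, Finset.sum_mul, Finset.sum_filter]
  congr 1
  refine Finset.sum_congr rfl fun e _ => ?_
  rw [mul_assoc, D.gs_mul_vx]
  split_ifs <;> simp

theorem split (F : Finset E) (x : L) :
    x = D.hh F * x + ∑ e ∈ F, D.eg e * (D.gs e * x) := by
  rw [hh, sub_mul, one_mul, Finset.sum_mul]
  simp [mul_assoc]

theorem ev_single (w : V × List E) (c : K) : D.ev (Finsupp.single w c) = c • D.mo w := by
  simp [ev, evl, Finsupp.linearCombination_single, mono, mo, gh]

theorem ev_apply (Γ : (V × List E) →₀ K) : D.ev Γ = ∑ w ∈ Γ.support, Γ w • D.mo w := by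
  simp [ev, evl, Finsupp.linearCombination_apply, mono, mo, gh, Finsupp.sum]

theorem mem_Gs {S : Set (V × List E)} {x : L} :
    x ∈ D.Gs S ↔ ∃ Γ : (V × List E) →₀ K, (∀ w, Γ w ≠ 0 → w ∈ S) ∧ D.ev Γ = x := by
  rw [Gs, Finsupp.mem_span_image_iff_linearCombination]
  constructor
  · rintro ⟨Γ, h1, h2⟩
    refine ⟨Γ, fun w hw => (Finsupp.mem_supported K Γ).1 h1 (by simpa using hw), h2⟩
  · rintro ⟨Γ, h1, h2⟩
    refine ⟨Γ, (Finsupp.mem_supported K Γ).2 fun w hw => h1 w (by simpa using hw), h2⟩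

theorem Gs_mono {S T : Set (V × List E)} (h : S ⊆ T) : D.Gs S ≤ D.Gs T :=
  Submodule.span_mono (Set.image_mono h)

theorem mo_mem {S : Set (V × List E)} {w} (h : w ∈ S) : D.mo w ∈ D.Gs S :=
  Submodule.subset_span ⟨w, h, rfl⟩

theorem Gs_map {S T : Set (V × List E)} (f : L →ₗ[K] L)
    (h : ∀ w ∈ S, f (D.mo w) ∈ D.Gs T) {x : L} (hx : x ∈ D.Gs S) : f x ∈ D.Gs T := by
  have : D.Gs S ≤ (D.Gs T).comap f := by
    rw [Gs, Submodule.span_le]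
    rintro _ ⟨w, hw, rfl⟩
    exact h w hw
  exact this hx

theorem vx_mem {S T : Set (V × List E)} (hS : ∀ w ∈ S, Vd s r w.1 w.2) (v : V)
    (h : ∀ w ∈ S, v = tgt r w.1 w.2 → w ∈ T) {x : L} (hx : x ∈ D.Gs S) :
    D.vx v * x ∈ D.Gs T := by
  refine D.Gs_map (LinearMap.mulLeft K (D.vx v)) ?_ hx
  intro w hw
  rw [LinearMap.mulLeft_apply, D.vx_mul_mo (hS w hw)]
  split_ifs with h'
  · exact D.mo_mem (h w hw h')
  · exact zero_mem _

theorem gs_mul_mo (w : V × List E) (e : E) : D.gs e * D.mo w = D.mo (w.1, w.2 ++ [e]) := by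
  simp [mo, gh_append, gh_cons, mul_assoc]

theorem gs_mem {S T : Set (V × List E)} (hS : ∀ w ∈ S, Vd s r w.1 w.2) (e : E)
    (h : ∀ w ∈ S, s e = tgt r w.1 w.2 → (w.1, w.2 ++ [e]) ∈ T) {x : L} (hx : x ∈ D.Gs S) :
    D.gs e * x ∈ D.Gs T := by
  refine D.Gs_map (LinearMap.mulLeft K (D.gs e)) ?_ hx
  intro w hw
  rw [LinearMap.mulLeft_apply]
  by_cases h' : s e = tgt r w.1 w.2
  · rw [gs_mul_mo]
    exact D.mo_mem (h w hw h')
  · rw [← D.gs_src, mul_assoc, D.vx_mul_mo (hS w hw), if_neg h', mul_zero]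
    exact zero_mem _

theorem exists_vx {x : L} (hx : x ≠ 0) : ∃ v, D.vx v * x ≠ 0 := by
  by_contra! h
  apply hx
  rw [← one_mul x, D.one_eq, Finset.sum_mul]
  exact Finset.sum_eq_zero fun v _ => h v

/-- formal left multiplication by a ghost path -/
noncomputable def app (m : List E) : ((V × List E) →₀ K) →ₗ[K] ((V × List E) →₀ K) :=
  Finsupp.lmapDomain K K (fun w => (w.1, w.2 ++ m))

theorem app_inj_aux (m : List E) :
    Function.Injective (fun w : V × List E => (w.1, w.2 ++ m)) := by
  rintro ⟨u, l⟩ ⟨u', l'⟩ h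
  simpa using h

theorem ev_app (m : List E) (Γ : (V × List E) →₀ K) : D.ev (app m Γ) = D.gh m * D.ev Γ := by
  induction Γ using Finsupp.induction_linear with
  | zero => simp
  | add f g hf hg => simp only [map_add, hf, hg, mul_add]
  | single w c =>
    simp [app, Finsupp.mapDomain_single, ev_single, mo, gh_append, mul_assoc]

theorem app_apply (m : List E) (Γ : (V × List E) →₀ K) (u l) :
    (app m Γ) (u, l ++ m) = Γ (u, l) := by
  exact Finsupp.mapDomain_apply (app_inj_aux m) Γ (u, l)

theorem app_ne_zero {m : List E} {Γ : (V × List E) →₀ K} {w} (h : (app m Γ) w ≠ 0) :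
    ∃ l, w = (w.1, l ++ m) ∧ Γ (w.1, l) ≠ 0 := by
  by_cases hw : w ∈ Set.range (fun w : V × List E => (w.1, w.2 ++ m))
  · obtain ⟨⟨u, l⟩, rfl⟩ := hw
    exact ⟨l, rfl, by simpa [app_apply] using h⟩
  · exact absurd (Finsupp.mapDomain_of_notMem_range Γ w hw) h

theorem gs_ne_zero {x : L} (hx : x ∈ D.Gs {w | Vd s r w.1 w.2}) {e : E}
    (h : D.vx (s e) * x ≠ 0) : D.gs e * x ≠ 0 := by
  intro h0
  have hy : D.vx (s e) * x ∈ D.Gs {w | Vd s r w.1 w.2 ∧ s e = tgt r w.1 w.2} :=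
    D.vx_mem (S := {w | Vd s r w.1 w.2}) (T := {w | Vd s r w.1 w.2 ∧ s e = tgt r w.1 w.2})
      (fun w hw => hw) _ (fun w hw h => ⟨hw, h⟩) hx
  obtain ⟨Γ, h1, h2⟩ := D.mem_Gs.1 hy
  rw [← D.gs_src, mul_assoc, ← h2] at h0
  have h3 : D.gs e = D.gh [e] := by simp [gh_cons]
  rw [h3, ← ev_app] at h0
  have h4 := D.indep _ (fun w hw => by
    obtain ⟨l, hl, hne⟩ := app_ne_zero hw
    rw [hl]
    obtain ⟨h5, h6⟩ := h1 _ hne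
    exact (Vd_append s r _ _ _).2 ⟨h5, by simpa [Vd] using h6⟩) h0
  have h5 : Γ = 0 := by
    apply Finsupp.mapDomain_injective (app_inj_aux [e])
    rw [Finsupp.mapDomain_zero]; exact h4
  exact h (by rw [← h2, h5, map_zero])

end LDat
end LPAProof
namespace LPAProof
namespace LDat
open Classical

variable {K V E L : Type} [Field K] [Fintype V] [Ring L] [Algebra K L] {s r : E → V}
  (D : LDat K V E L s r)

/-- paths with all edges in `F` -/
def SF (s r : E → V) (F : Finset E) : Set (V × List E) :=
  {w | Vd s r w.1 w.2 ∧ ∀ e ∈ w.2, e ∈ F}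

/-- filtration of the algebra -/
noncomputable def T (F : Finset E) : ℕ → Submodule K L
  | 0 => D.Gs (SF s r F)
  | n + 1 => T F n ⊔ Submodule.span K {x | ∃ e ∈ F, ∃ y ∈ T F n, x = D.eg e * y}

theorem T_le_succ (F : Finset E) (n : ℕ) : D.T F n ≤ D.T F (n + 1) := le_sup_left

theorem eg_mem_T {F : Finset E} {n : ℕ} {e : E} (he : e ∈ F) {y : L} (hy : y ∈ D.T F n) :
    D.eg e * y ∈ D.T F (n + 1) :=
  Submodule.mem_sup_right (Submodule.subset_span ⟨e, he, y, hy, rfl⟩)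

theorem T_succ_le {F : Finset E} {n : ℕ} {U : Submodule K L} (h1 : D.T F n ≤ U)
    (h2 : ∀ e ∈ F, ∀ y ∈ D.T F n, D.eg e * y ∈ U) : D.T F (n + 1) ≤ U := by
  refine sup_le h1 (Submodule.span_le.2 ?_)
  rintro _ ⟨e, he, y, hy, rfl⟩
  exact h2 e he y hy

theorem T_mono_right (F : Finset E) : Monotone (D.T F) := monotone_nat_of_le_succ (D.T_le_succ F)

theorem T_mono_left {F F' : Finset E} (h : F ⊆ F') (n : ℕ) : D.T F n ≤ D.T F' n := by
  induction n with
  | zero => exact D.Gs_mono fun w hw => ⟨hw.1, fun e he => h (hw.2 e he)⟩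
  | succ n ih =>
    exact D.T_succ_le (ih.trans (D.T_le_succ _ _)) fun e he y hy => D.eg_mem_T (h he) (ih hy)

theorem T_vx {F : Finset E} {n : ℕ} (v : V) : D.T F n ≤ (D.T F n).comap
    (LinearMap.mulLeft K (D.vx v)) := by
  induction n with
  | zero => exact fun x hx => D.vx_mem (fun w hw => hw.1) v (fun w hw _ => hw) hx
  | succ n ih =>
    refine D.T_succ_le (fun x hx => D.T_le_succ _ _ (ih hx)) fun e he y hy => ?_
    rw [Submodule.mem_comap, LinearMap.mulLeft_apply, ← mul_assoc, D.vx_mul_eg]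
    split_ifs
    · exact D.eg_mem_T he hy
    · rw [zero_mul]; exact zero_mem _

theorem T_gs {F : Finset E} {n : ℕ} {e : E} (he : e ∈ F) : D.T F n ≤ (D.T F n).comap
    (LinearMap.mulLeft K (D.gs e)) := by
  induction n with
  | zero =>
    refine fun x hx => D.gs_mem (S := SF s r F) (T := SF s r F) (fun w hw => hw.1) e (fun w hw h => ⟨?_, ?_⟩) hx
    · exact (Vd_append s r _ _ _).2 ⟨hw.1, by simpa [Vd] using h⟩
    · intro e' he'
      rcases List.mem_append.1 he' with h' | h'
      · exact hw.2 _ h'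
      · rw [List.mem_singleton.1 h']; exact he
  | succ n ih =>
    refine D.T_succ_le (fun x hx => D.T_le_succ _ _ (ih hx)) fun f hf y hy => ?_
    rw [Submodule.mem_comap, LinearMap.mulLeft_apply, ← mul_assoc, D.gs_mul_eg]
    split_ifs
    · exact D.T_le_succ _ _ (D.T_vx _ hy)
    · rw [zero_mul]; exact zero_mem _

theorem T_gs' {F : Finset E} {n : ℕ} {e : E} (he : e ∈ F) {x : L} (hx : x ∈ D.T F (n + 1)) :
    D.gs e * x ∈ D.T F n := by
  have : D.T F (n + 1) ≤ (D.T F n).comap (LinearMap.mulLeft K (D.gs e)) := by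
    refine D.T_succ_le (D.T_gs he) fun f hf y hy => ?_
    rw [Submodule.mem_comap, LinearMap.mulLeft_apply, ← mul_assoc, D.gs_mul_eg]
    split_ifs
    · exact D.T_vx _ hy
    · rw [zero_mul]; exact zero_mem _
  exact this hx

theorem T_hh {F : Finset E} {n : ℕ} {x : L} (hx : x ∈ D.T F n) :
    ∃ y ∈ D.Gs (SF s r F), D.hh F * x = D.hh F * y := by
  have : D.T F n ≤ ((D.Gs (SF s r F)).map (LinearMap.mulLeft K (D.hh F))).comap
      (LinearMap.mulLeft K (D.hh F)) := by
    clear hx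
    induction n with
    | zero => exact fun x hx => ⟨x, hx, rfl⟩
    | succ n ih =>
      refine D.T_succ_le ih fun f hf y hy => ?_
      · rw [Submodule.mem_comap, LinearMap.mulLeft_apply, ← mul_assoc, D.hh_mul_eg hf, zero_mul]
        exact zero_mem _
  obtain ⟨y, hy, h⟩ := this hx
  exact ⟨y, hy, h.symm⟩

theorem exists_T (x : L) : ∃ F n, x ∈ D.T F n := by
  let U : Submodule K L :=
    { carrier := {x | ∃ F n, x ∈ D.T F n}
      zero_mem' := ⟨∅, 0, zero_mem _⟩
      add_mem' := by
        rintro a b ⟨F, n, h⟩ ⟨F', n', h'⟩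
        refine ⟨F ∪ F', max n n', add_mem ?_ ?_⟩
        · exact D.T_mono_right _ (le_max_left _ _) (D.T_mono_left Finset.subset_union_left _ h)
        · exact D.T_mono_right _ (le_max_right _ _) (D.T_mono_left Finset.subset_union_right _ h')
      smul_mem' := by
        rintro c a ⟨F, n, h⟩
        exact ⟨F, n, Submodule.smul_mem _ _ h⟩ }
  refine D.ind U ?_ ?_ ?_ ?_ x
  · refine ⟨∅, 0, ?_⟩
    rw [D.one_eq]
    refine Submodule.sum_mem _ fun v _ => ?_
    have : D.vx v = D.mo (v, []) := by simp [mo]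
    rw [this]
    exact D.mo_mem ⟨trivial, by simp⟩
  · rintro v x ⟨F, n, h⟩
    exact ⟨F, n, D.T_vx v h⟩
  · rintro e x ⟨F, n, h⟩
    exact ⟨insert e F, n + 1, D.eg_mem_T (Finset.mem_insert_self _ _)
      (D.T_mono_left (Finset.subset_insert _ _) _ h)⟩
  · rintro e x ⟨F, n, h⟩
    exact ⟨insert e F, n, D.T_gs (Finset.mem_insert_self _ _)
      (D.T_mono_left (Finset.subset_insert _ _) _ h)⟩

theorem exists_T_fam {ι : Type} (S : Finset ι) (t : ι → L) :
    ∃ F n, ∀ i ∈ S, t i ∈ D.T F n := by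
  choose F n h using fun i => D.exists_T (t i)
  refine ⟨S.biUnion F, S.sup n, fun i hi => ?_⟩
  exact D.T_mono_right _ (Finset.le_sup hi)
    (D.T_mono_left (Finset.subset_biUnion_of_mem F hi) _ (h i))

/-- ideals generated by elements of the filtration are generated by simple ones -/
theorem gens {F : Finset E} {I : Submodule L L} {n : ℕ} {x : L} (hx : x ∈ D.T F n) (hI : x ∈ I) :
    x ∈ Submodule.span L {y | y ∈ I ∧ ∃ γ ∈ D.Gs (SF s r F), y = γ ∨ y = D.hh F * γ} := by
  induction n generalizing x with
  | zero => exact Submodule.subset_span ⟨hI, x, hx, Or.inl rfl⟩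
  | succ n ih =>
    rw [D.split F x]
    refine add_mem ?_ (Submodule.sum_mem _ fun e he => ?_)
    · obtain ⟨y, hy, h⟩ := D.T_hh hx
      exact Submodule.subset_span ⟨I.smul_mem _ hI, y, hy, Or.inr h⟩
    · exact Submodule.smul_mem _ _ (ih (D.T_gs' he hx) (I.smul_mem _ hI))

/-- paths of positive length, or trivial paths at a sink -/
def SP (s r : E → V) : Set (V × List E) :=
  {w | Vd s r w.1 w.2 ∧ (w.2 = [] → ∀ e, s e ≠ w.1)}

theorem red_zero {ι : Type} (t : ι → L) (i₀ : ι) (ht : ∀ i, t i ∈ D.Gs {w | Vd s r w.1 w.2})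
    (h0 : t i₀ ≠ 0) : ∃ y, (∀ i, y * t i ∈ D.Gs (SP s r)) ∧ y * t i₀ ≠ 0 := by
  obtain ⟨v, hv⟩ := D.exists_vx h0
  by_cases hs : ∃ e, s e = v
  · obtain ⟨e, rfl⟩ := hs
    refine ⟨D.gs e, fun i => ?_, D.gs_ne_zero (ht i₀) hv⟩
    refine D.gs_mem (S := {w | Vd s r w.1 w.2}) (T := SP s r) (fun w hw => hw) e (fun w hw h => ⟨?_, ?_⟩) (ht i)
    · exact (Vd_append s r _ _ _).2 ⟨hw, by simpa [Vd] using h⟩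
    · simp
  · push Not at hs
    refine ⟨D.vx v, fun i => ?_, hv⟩
    refine D.vx_mem (S := {w | Vd s r w.1 w.2}) (T := SP s r) (fun w hw => hw) v (fun w hw h => ⟨hw, ?_⟩) (ht i)
    intro hw2
    rw [hw2] at h
    simp only [tgt] at h
    rw [← h]; exact hs

theorem red {F : Finset E} {n : ℕ} {ι : Type} (t : ι → L) (i₀ : ι) (ht : ∀ i, t i ∈ D.T F n)
    (h0 : t i₀ ≠ 0) : ∃ y, (∀ i, y * t i ∈ D.Gs (SP s r)) ∧ y * t i₀ ≠ 0 := by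
  have hSF : SF s r F ⊆ {w | Vd s r w.1 w.2} := fun w hw => hw.1
  induction n generalizing t with
  | zero => exact D.red_zero t i₀ (fun i => D.Gs_mono hSF (ht i)) h0
  | succ n ih =>
    by_cases hc : ∃ e ∈ F, D.gs e * t i₀ ≠ 0
    · obtain ⟨e, he, hne⟩ := hc
      obtain ⟨y, h1, h2⟩ := ih (fun i => D.gs e * t i) (fun i => D.T_gs' he (ht i)) hne
      exact ⟨y * D.gs e, fun i => by rw [mul_assoc]; exact h1 i, by rw [mul_assoc]; exact h2⟩
    · push Not at hc
      suffices h : ∃ y, (∀ i, y * t i ∈ D.Gs {w | Vd s r w.1 w.2}) ∧ y * t i₀ ≠ 0 by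
        obtain ⟨z, h1, h2⟩ := h
        obtain ⟨y, h3, h4⟩ := D.red_zero (fun i => z * t i) i₀ h1 h2
        exact ⟨y * z, fun i => by rw [mul_assoc]; exact h3 i, by rw [mul_assoc]; exact h4⟩
      have hh0 : D.hh F * t i₀ ≠ 0 := by
        have := D.split F (t i₀)
        rw [Finset.sum_eq_zero (fun e he => by rw [hc e he, mul_zero]), add_zero] at this
        rwa [← this]
      choose γ hγ hγ2 using fun i => D.T_hh (ht i)
      obtain ⟨v, hv⟩ := D.exists_vx hh0
      have hvγ : D.vx v * γ i₀ ≠ 0 := by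
        intro h
        apply hv
        rw [hγ2, ← mul_assoc, ← D.hh_vx, mul_assoc, h, mul_zero]
      by_cases hs : ∃ e, e ∉ F ∧ s e = v
      · obtain ⟨e, he, rfl⟩ := hs
        have key : ∀ i, D.gs e * t i = D.gs e * γ i := by
          intro i
          have : D.gs e * D.hh F = D.gs e := by rw [D.gs_mul_hh, if_neg he]
          rw [← this, mul_assoc, mul_assoc, hγ2]
        refine ⟨D.gs e, fun i => ?_, ?_⟩
        · rw [key]
          refine D.gs_mem (S := SF s r F) (fun w hw => hw.1) e (fun w hw h => ?_) (hγ i)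
          exact (Vd_append s r _ _ _).2 ⟨hw.1, by simpa [Vd] using h⟩
        · rw [key]
          exact D.gs_ne_zero (D.Gs_mono hSF (hγ i₀)) hvγ
      · push Not at hs
        by_cases hs2 : ∃ e, s e = v
        · exfalso
          apply hv
          rw [← mul_assoc, D.vx_hh, ← D.ck2 v (F.filter (fun e => s e = v)), sub_self, zero_mul]
          · intro e
            rw [Finset.mem_filter]
            refine ⟨fun h => h.2, fun h => ⟨?_, h⟩⟩
            by_contra h'
            exact hs e h' h
          · obtain ⟨e, he⟩ := hs2
            refine ⟨e, Finset.mem_filter.2 ⟨?_, he⟩⟩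
            by_contra h'
            exact hs e h' he
        · push Not at hs2
          have key : ∀ i, D.vx v * t i = D.vx v * γ i := by
            intro i
            have : D.vx v * D.hh F = D.vx v := by
              rw [D.vx_hh, Finset.sum_eq_zero, sub_zero]
              intro e he
              exact absurd (Finset.mem_filter.1 he).2 (hs2 e)
            rw [← this, mul_assoc, mul_assoc, hγ2]
          refine ⟨D.vx v, fun i => ?_, ?_⟩
          · rw [key]
            exact D.vx_mem (S := SF s r F) (fun w hw => hw.1) v (fun w hw h => hw.1) (hγ i)
          · rw [key]; exact hvγ

end LDat
end LPAProof
namespace LPAProof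
namespace LDat
open Classical

variable {K V E L : Type} [Field K] [Fintype V] [Ring L] [Algebra K L] {s r : E → V}
  (D : LDat K V E L s r)

theorem exists_max_rel {W : Type} (lt : W → W → Prop) [IsWellOrder W lt] {α : Type}
    (S : Finset α) (hS : S.Nonempty) (f : α → W) :
    ∃ a ∈ S, ∀ b ∈ S, f b = f a ∨ lt (f b) (f a) := by
  let _ : LinearOrder W := IsWellOrder.linearOrder lt
  obtain ⟨a, ha, h⟩ := S.exists_max_image f hS
  exact ⟨a, ha, fun b hb => h b hb⟩

/-- paths in `F` ending at `v` -/
def SFv (s r : E → V) (F : Finset E) (v : V) : Set (V × List E) :=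
  {w | Vd s r w.1 w.2 ∧ tgt r w.1 w.2 = v ∧ ∀ e ∈ w.2, e ∈ F}

/-- `Γ` is monic with leading word `w` -/
def Lead (lt : V × List E → V × List E → Prop) (Γ : (V × List E) →₀ K) (w : V × List E) : Prop :=
  Γ w = 1 ∧ ∀ w', Γ w' ≠ 0 → w' = w ∨ lt w' w

/-- the two kinds of left multipliers -/
noncomputable def th (F : Finset E) (b : Bool) : L := if b = true then 1 else D.hh F

/-- data attached to a leading word -/
def IsN (lt : V × List E → V × List E → Prop) (I : Submodule L L) (F : Finset E) (b : Bool)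
    (w : V × List E) (Γ : (V × List E) →₀ K) : Prop :=
  (∀ w', Γ w' ≠ 0 → w' ∈ SFv s r F (tgt r w.1 w.2)) ∧ Lead lt Γ w ∧ D.th F b * D.ev Γ ∈ I

/-- `w` is a leading word of the given kind -/
def NN (lt : V × List E → V × List E → Prop) (I : Submodule L L) (F : Finset E) (b : Bool)
    (w : V × List E) : Prop := ∃ Γ, D.IsN lt I F b w Γ

/-- indices of the reduced generators -/
def Good (lt : V × List E → V × List E → Prop) (I : Submodule L L) (F : Finset E)
    (i : Bool × V × List E) : Prop :=
  D.NN lt I F i.1 i.2 ∧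
  (i.1 = true → ∀ l m, i.2.2 = l ++ m → m ≠ [] → ¬ D.NN lt I F true (i.2.1, l)) ∧
  (i.1 = false → ¬ D.NN lt I F true i.2)

theorem th_true (F : Finset E) : D.th F true = 1 := by simp [th]
theorem th_false (F : Finset E) : D.th F false = D.hh F := by simp [th]

theorem th_vx (F : Finset E) (b : Bool) (v : V) : D.th F b * D.vx v = D.vx v * D.th F b := by
  cases b
  · rw [th_false, hh_vx]
  · simp [th_true]

theorem th_idem (F : Finset E) (b : Bool) : D.th F b * D.th F b = D.th F b := by
  cases b
  · rw [th_false, hh_idem]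
  · simp [th_true]

theorem ev_vx {Γ : (V × List E) →₀ K} {F : Finset E} {v : V}
    (h : ∀ w, Γ w ≠ 0 → w ∈ SFv s r F v) : D.vx v * D.ev Γ = D.ev Γ := by
  rw [ev_apply, Finset.mul_sum]
  refine Finset.sum_congr rfl fun w hw => ?_
  have := h w (by simpa using hw)
  rw [mul_smul_comm, D.vx_mul_mo this.1, if_pos this.2.1.symm]

section
variable {lt : V × List E → V × List E → Prop} [IsWellOrder _ lt]
  (hlt : ∀ u l u' l' m, lt (u, l) (u', l') → lt (u, l ++ m) (u', l' ++ m))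
  {I : Submodule L L} {F : Finset E}

theorem NN_mem {b : Bool} {w} (h : D.NN lt I F b w) : w ∈ SFv s r F (tgt r w.1 w.2) := by
  obtain ⟨Γ, h1, h2, _⟩ := h
  exact h1 w (by rw [h2.1]; exact one_ne_zero)

theorem app_supp {Γ : (V × List E) →₀ K} {v : V} (h : ∀ w, Γ w ≠ 0 → w ∈ SFv s r F v)
    {m : List E} (hm : Vd s r v m) (hF : ∀ e ∈ m, e ∈ F) :
    ∀ w, app m Γ w ≠ 0 → w ∈ SFv s r F (tgt r v m) := by
  intro w hw
  obtain ⟨l, h1, h2⟩ := app_ne_zero hw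
  obtain ⟨h3, h4, h5⟩ := h _ h2
  simp only at h3 h4 h5
  rw [h1]
  refine ⟨(Vd_append s r _ _ _).2 ⟨h3, by rwa [h4]⟩, by rw [tgt_append, h4], ?_⟩
  intro e he
  rcases List.mem_append.1 he with h' | h'
  · exact h5 _ h'
  · exact hF _ h'

include hlt in
theorem app_lead {Γ : (V × List E) →₀ K} {u : V} {l : List E} (h : Lead lt Γ (u, l))
    (m : List E) : Lead lt (app m Γ) (u, l ++ m) := by
  refine ⟨by rw [app_apply]; exact h.1, fun w hw => ?_⟩
  obtain ⟨l', h1, h2⟩ := app_ne_zero hw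
  rw [h1]
  rcases h.2 _ h2 with h3 | h3
  · left
    obtain ⟨h4, h5⟩ := Prod.mk.inj h3
    rw [h4, h5]
  · right
    exact hlt _ _ _ _ _ h3

include hlt in
theorem NN_ext {u : V} {l m : List E} (h : D.NN lt I F true (u, l))
    (hm : Vd s r (tgt r u l) m) (hF : ∀ e ∈ m, e ∈ F) : D.NN lt I F true (u, l ++ m) := by
  obtain ⟨Γ, h1, h2, h3⟩ := h
  refine ⟨app m Γ, ?_, app_lead hlt h2 m, ?_⟩
  · have := app_supp h1 hm hF
    simpa only [tgt_append] using this
  · rw [th_true, one_mul] at h3 ⊢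
    rw [ev_app]
    exact I.smul_mem _ h3

include hlt in
/-- key incomparability -/
theorem incomp {i j : Bool × V × List E} (hi : D.Good lt I F i) (hj : D.Good lt I F j)
    (hij : i ≠ j) (hu : i.2.1 = j.2.1) {m : List E} (hm : j.2.2 = i.2.2 ++ m) :
    i.1 = false ∧ ∃ e m', m = e :: m' ∧ e ∈ F := by
  obtain ⟨b, u, l⟩ := i
  obtain ⟨b', u', l'⟩ := j
  simp only at hu hm
  subst hu hm
  have hjF := (D.NN_mem hj.1)
  obtain ⟨hv, -, hF⟩ := hjF
  simp only [Vd_append, List.mem_append] at hv hF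
  have hFm : ∀ e ∈ m, e ∈ F := fun e he => hF e (Or.inr he)
  have hext : b = true → D.NN lt I F true (u, l ++ m) := by
    rintro rfl
    exact D.NN_ext hlt hi.1 hv.2 hFm
  cases m with
  | nil =>
    exfalso
    simp only [List.append_nil] at *
    cases b <;> cases b'
    · exact hij rfl
    · exact hi.2.2 rfl hj.1
    · exact hj.2.2 rfl hi.1
    · exact hij rfl
  | cons e m =>
    refine ⟨?_, e, m, rfl, hFm e (by simp)⟩
    cases b
    · rfl
    · exfalso
      cases b'
      · exact hj.2.2 rfl (hext rfl)
      · exact hj.2.1 rfl l (e :: m) rfl (by simp) hi.1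

theorem min_pref (n : ℕ) (u : V) (l : List E) (hn : l.length = n) (h : D.NN lt I F true (u, l)) :
    ∃ l' m, l = l' ++ m ∧ D.Good lt I F (true, u, l') := by
  induction n using Nat.strong_induction_on generalizing l with
  | _ n ih =>
    by_cases hc : ∃ l' m, l = l' ++ m ∧ m ≠ [] ∧ D.NN lt I F true (u, l')
    · obtain ⟨l', m, rfl, hm, h'⟩ := hc
      have hlen : l'.length < n := by
        rw [← hn, List.length_append]
        have := List.length_pos_of_ne_nil hm
        omega
      obtain ⟨l'', m', rfl, h2⟩ := ih _ hlen l' rfl h'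
      exact ⟨l'', m' ++ m, by simp, h2⟩
    · push Not at hc
      exact ⟨l, [], by simp, h, fun _ l' m h1 h2 => hc l' m h1 h2, by simp⟩

include hlt in
theorem generate (g : Bool × V × List E → ((V × List E) →₀ K))
    (hg : ∀ i, D.Good lt I F i → D.IsN lt I F i.1 i.2 (g i)) (w : V × List E) :
    ∀ (v : V) (Γ : (V × List E) →₀ K), (∀ w', Γ w' ≠ 0 → w' ∈ SFv s r F v) → Γ w ≠ 0 →
      (∀ w', Γ w' ≠ 0 → w' = w ∨ lt w' w) → ∀ b, D.th F b * D.ev Γ ∈ I →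
      D.th F b * D.ev Γ ∈
        Submodule.span L ((fun i => D.th F i.1 * D.ev (g i)) '' {i | D.Good lt I F i}) := by
  induction w using (IsWellFounded.wf : WellFounded lt).induction with
  | _ w IH =>
    intro v Γ hΓ hw hmax b hb
    have hwv : tgt r w.1 w.2 = v := (hΓ w hw).2.1
    have hN : D.NN lt I F b w := by
      refine ⟨(Γ w)⁻¹ • Γ, fun w' h => ?_, ⟨?_, fun w' h => ?_⟩, ?_⟩
      · rw [hwv]; exact hΓ w' (by intro h0; apply h; simp [h0])
      · simp [hw]
      · exact hmax w' (by intro h0; apply h; simp [h0])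
      · rw [map_smul, mul_smul_comm]
        exact Submodule.smul_of_tower_mem _ _ hb
    set J := Submodule.span L ((fun i => D.th F i.1 * D.ev (g i)) '' {i | D.Good lt I F i}) with hJ
    have hgen : ∀ i, D.Good lt I F i → D.th F i.1 * D.ev (g i) ∈ J := fun i hi =>
      Submodule.subset_span ⟨i, hi, rfl⟩
    have key : ∃ Δ : (V × List E) →₀ K, (∀ w', Δ w' ≠ 0 → w' ∈ SFv s r F v) ∧ Lead lt Δ w ∧
        D.th F b * D.ev Δ ∈ I ∧ D.th F b * D.ev Δ ∈ J := by
      by_cases hA : D.NN lt I F true w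
      · obtain ⟨u, l⟩ := w
        obtain ⟨l', m, rfl, hG⟩ := D.min_pref _ u l rfl hA
        obtain ⟨h1, h2, h3⟩ := hg _ hG
        have hv := D.NN_mem hA
        obtain ⟨hv, -, hF⟩ := hv
        simp only [Vd_append, List.mem_append] at hv hF
        have h4 := hgen _ hG
        simp only [th_true, one_mul] at h3 h4
        refine ⟨app m (g (true, u, l')), ?_, app_lead hlt h2 m, ?_, ?_⟩
        · have := app_supp h1 hv.2 (fun e he => hF e (Or.inr he))
          simp only [tgt_append] at hwv
          rwa [← hwv]
        · rw [ev_app, ← mul_assoc]; exact I.smul_mem _ h3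
        · rw [ev_app, ← mul_assoc]; exact J.smul_mem _ h4
      · have hbf : b = false := by
          cases b
          · rfl
          · exact absurd hN hA
        subst hbf
        have hG : D.Good lt I F (false, w) := ⟨hN, by simp, fun _ => hA⟩
        obtain ⟨h1, h2, h3⟩ := hg _ hG
        exact ⟨g (false, w), by rwa [← hwv], h2, h3, hgen _ hG⟩
    obtain ⟨Δ, d1, d2, d3, d4⟩ := key
    have hsplit : D.th F b * D.ev Γ =
        D.th F b * D.ev (Γ - Γ w • Δ) + Γ w • (D.th F b * D.ev Δ) := by
      rw [map_sub, map_smul, mul_sub, mul_smul_comm]; abel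
    rw [hsplit]
    refine add_mem ?_ (Submodule.smul_of_tower_mem _ _ d4)
    by_cases h0 : Γ - Γ w • Δ = 0
    · rw [h0]; simp
    obtain ⟨w', hw', hmax'⟩ := exists_max_rel lt (Γ - Γ w • Δ).support
      (Finsupp.support_nonempty_iff.2 h0) id
    have hsub : ∀ x, (Γ - Γ w • Δ) x ≠ 0 → Γ x ≠ 0 ∨ Δ x ≠ 0 := by
      intro x hx
      by_contra! hcon
      apply hx
      simp [hcon.1, hcon.2]
    have hw'0 : (Γ - Γ w • Δ) w' ≠ 0 := by simpa using hw'
    have hlt' : lt w' w := by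
      have : w' ≠ w := by
        rintro rfl
        apply hw'0
        simp [d2.1]
      rcases hsub _ hw'0 with h | h
      · exact (hmax _ h).resolve_left this
      · exact (d2.2 _ h).resolve_left this
    refine IH w' hlt' v _ ?_ hw'0 ?_ b ?_
    · intro x hx
      rcases hsub x hx with h | h
      · exact hΓ x h
      · exact d1 x h
    · intro x hx
      exact hmax' x (by simpa using hx)
    · have : D.th F b * D.ev (Γ - Γ w • Δ) = D.th F b * D.ev Γ - Γ w • (D.th F b * D.ev Δ) := by
        rw [hsplit]; abel
      rw [this]
      exact sub_mem hb (Submodule.smul_of_tower_mem _ _ d3)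

include hlt in
theorem generate' (g : Bool × V × List E → ((V × List E) →₀ K))
    (hg : ∀ i, D.Good lt I F i → D.IsN lt I F i.1 i.2 (g i)) {n : ℕ} {x : L}
    (hx : x ∈ D.T F n) (hI : x ∈ I) :
    x ∈ Submodule.span L ((fun i => D.th F i.1 * D.ev (g i)) '' {i | D.Good lt I F i}) := by
  refine Submodule.span_le.2 ?_ (D.gens hx hI)
  rintro y ⟨hyI, γ, hγ, hy⟩
  have : ∃ b, y = D.th F b * γ := by
    rcases hy with h | h
    · exact ⟨true, by rw [h, th_true, one_mul]⟩
    · exact ⟨false, by rw [h, th_false]⟩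
  obtain ⟨b, rfl⟩ := this
  have hsum : D.th F b * γ = ∑ v, D.th F b * (D.vx v * γ) := by
    rw [← Finset.mul_sum, ← Finset.sum_mul, ← D.one_eq, one_mul]
  rw [hsum]
  refine Submodule.sum_mem _ fun v _ => ?_
  have h1 : D.th F b * (D.vx v * γ) ∈ I := by
    rw [← mul_assoc, th_vx, mul_assoc]; exact I.smul_mem _ hyI
  have h2 : D.vx v * γ ∈ D.Gs (SFv s r F v) :=
    D.vx_mem (S := SF s r F) (T := SFv s r F v) (fun w hw => hw.1) v
      (fun w hw h => ⟨hw.1, h.symm, hw.2⟩) hγ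
  obtain ⟨Γ, h3, h4⟩ := D.mem_Gs.1 h2
  rw [← h4] at h1 ⊢
  by_cases h0 : Γ = 0
  · rw [h0]; simp
  obtain ⟨w, hw, hmax⟩ := exists_max_rel lt Γ.support (Finsupp.support_nonempty_iff.2 h0) id
  exact D.generate hlt g hg w v Γ h3 (by simpa using hw)
    (fun w' hw' => hmax w' (by simpa using hw')) b h1

/-- the path attached to an index -/
noncomputable def pp (F : Finset E) (i : Bool × V × List E) : L :=
  D.vx i.2.1 * D.ed i.2.2 * D.th F i.1

/-- its adjoint -/
noncomputable def qq (F : Finset E) (i : Bool × V × List E) : L :=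
  D.th F i.1 * D.mo i.2

include hlt in
theorem orth {i j : Bool × V × List E} (hi : D.Good lt I F i) (hj : D.Good lt I F j)
    (hij : i ≠ j) : D.qq F i * D.pp F j = 0 := by
  have hvi := (D.NN_mem hi.1).1
  have hvj := (D.NN_mem hj.1).1
  have e1 : D.qq F i * D.pp F j =
      D.th F i.1 * (D.gh i.2.2 * (D.vx i.2.1 * D.vx j.2.1) * D.ed j.2.2) * D.th F j.1 := by
    simp only [qq, pp, mo, mul_assoc]
  rw [e1, D.vx_mul]
  split_ifs with hu
  swap
  · simp
  by_cases h1 : i.2.2 <+: j.2.2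
  · obtain ⟨m, hm⟩ := h1
    obtain ⟨hb, e, m', rfl, he⟩ := D.incomp hlt hi hj hij hu hm.symm
    rw [← hm, ed_append, ← mul_assoc (D.gh _ * _), D.gh_vx_ed hvi, hb, th_false, ed_cons,
      ← mul_assoc, ← mul_assoc, D.hh_vx, mul_assoc (D.vx _), D.hh_mul_eg he]
    simp
  by_cases h2 : j.2.2 <+: i.2.2
  · obtain ⟨m, hm⟩ := h2
    obtain ⟨hb, e, m', rfl, he⟩ := D.incomp hlt hj hi hij.symm hu.symm hm.symm
    have e2 : D.gh (j.2.2 ++ e :: m') * D.vx i.2.1 * D.ed j.2.2 =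
        D.gh (e :: m') * (D.gh j.2.2 * D.vx j.2.1 * D.ed j.2.2) := by
      rw [gh_append, hu]; simp only [mul_assoc]
    rw [← hm, e2, D.gh_vx_ed hvj, hb, th_false, gh_cons, mul_assoc, mul_assoc, ← D.hh_vx,
      mul_assoc (D.gh m'), ← mul_assoc (D.gs e), D.gs_mul_hh, if_pos he]
    simp
  · rw [D.gh_vx_ed_zero _ _ _ h1 h2]; simp

theorem qq_pp {i : Bool × V × List E} (hi : D.Good lt I F i) {Γ : (V × List E) →₀ K}
    (hΓ : D.IsN lt I F i.1 i.2 Γ) : D.qq F i * (D.pp F i * D.ev Γ) = D.th F i.1 * D.ev Γ := by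
  have hvi := (D.NN_mem hi.1).1
  have e1 : D.qq F i * (D.pp F i * D.ev Γ) =
      D.th F i.1 * (D.gh i.2.2 * (D.vx i.2.1 * D.vx i.2.1) * D.ed i.2.2) *
        (D.th F i.1 * D.ev Γ) := by
    simp only [qq, pp, mo, mul_assoc]
  rw [e1, D.vx_idem, D.gh_vx_ed hvi, D.th_vx, mul_assoc, ← mul_assoc (D.th F i.1), D.th_idem,
    ← mul_assoc, ← D.th_vx, mul_assoc, D.ev_vx hΓ.1]

theorem pp_right {i : Bool × V × List E} (hi : D.Good lt I F i) :
    D.pp F i * (D.vx (tgt r i.2.1 i.2.2) * D.th F i.1) = D.pp F i := by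
  have hvi := (D.NN_mem hi.1).1
  rw [← D.th_vx, pp, mul_assoc _ (D.th F i.1), ← mul_assoc (D.th F i.1), D.th_idem, D.th_vx,
    ← mul_assoc, D.ed_vx hvi]

/-- words allowed as coefficients -/
def SQ (s r : E → V) (F : Finset E) (i : Bool × V × List E) : Set (V × List E) :=
  {w | Vd s r w.1 w.2 ∧ w.1 = tgt r i.2.1 i.2.2 ∧
    (i.1 = false → ∀ e q, w.2 = e :: q → e ∉ F)}

theorem right_mem (i : Bool × V × List E) {x : L} (hx : x ∈ D.Gs (SP s r)) :
    x * (D.vx (tgt r i.2.1 i.2.2) * D.th F i.1) ∈ D.Gs (SQ s r F i) := by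
  refine D.Gs_map (LinearMap.mulRight K (D.vx (tgt r i.2.1 i.2.2) * D.th F i.1)) ?_ hx
  rintro ⟨u, l⟩ ⟨hv, hs⟩
  simp only at hv hs
  rw [LinearMap.mulRight_apply, mo, mul_assoc, ← mul_assoc (D.vx _), D.vx_mul]
  simp only
  split_ifs with hu
  swap
  · simp
  rcases hb : i.1 with _ | _
  · rw [th_false]
    cases l with
    | nil =>
      have e1 : D.gh [] * (D.vx u * D.hh F) = D.mo (u, []) := by
        rw [mo, D.vx_hh, Finset.sum_eq_zero, sub_zero]
        intro e he
        exact absurd (Finset.mem_filter.1 he).2 (hs rfl e)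
      rw [e1]
      exact D.mo_mem ⟨hv, hu, by simp⟩
    | cons e l =>
      rw [← D.hh_vx, gh_cons, mul_assoc, ← mul_assoc (D.gs e), D.gs_mul_hh]
      split_ifs with he
      · simp
      · rw [← mul_assoc]
        refine D.mo_mem (w := (u, e :: l)) ⟨hv, hu, ?_⟩
        intro _ e' q h
        simp only [List.cons.injEq] at h
        rw [← h.1]; exact he
  · rw [th_true, mul_one]
    exact D.mo_mem (w := (u, l)) ⟨hv, hu, by simp [hb]⟩

include hlt in
theorem inj_words {i j : Bool × V × List E} (hi : D.Good lt I F i) (hj : D.Good lt I F j)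
    {w w' : V × List E} (hw : w ∈ SQ s r F i) (hw' : w' ∈ SQ s r F j)
    (h : (i.2.1, i.2.2 ++ w.2) = (j.2.1, j.2.2 ++ w'.2)) : i = j ∧ w = w' := by
  obtain ⟨hu, hl⟩ := Prod.mk.inj h
  have hij : i = j := by
    by_contra hij
    rcases List.append_eq_append_iff.1 hl with ⟨m, h1, h2⟩ | ⟨m, h1, h2⟩
    · obtain ⟨hb, e, m', rfl, he⟩ := D.incomp hlt hi hj hij hu h1
      exact hw.2.2 hb e _ h2 he
    · obtain ⟨hb, e, m', rfl, he⟩ := D.incomp hlt hj hi (Ne.symm hij) hu.symm h1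
      exact hw'.2.2 hb e _ h2 he
  refine ⟨hij, ?_⟩
  subst hij
  exact Prod.ext (hw.2.1.trans hw'.2.1.symm) (by simpa using hl)

include hlt in
theorem independent (g : Bool × V × List E → ((V × List E) →₀ K))
    (hg : ∀ i, D.Good lt I F i → D.IsN lt I F i.1 i.2 (g i)) (S : Finset (Bool × V × List E))
    (hS : ∀ i ∈ S, D.Good lt I F i) (t : L)
    (h0 : ∑ i ∈ S, t * (D.pp F i * D.ev (g i)) = 0) : ∀ i ∈ S, t * D.pp F i = 0 := by
  intro i₀ hi₀
  by_contra hne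
  obtain ⟨F', n, hT⟩ := D.exists_T_fam S (fun i => t * D.pp F i)
  obtain ⟨y, hy1, hy2⟩ := D.red (ι := {i // i ∈ S}) (fun i => t * D.pp F i) ⟨i₀, hi₀⟩
    (fun i => hT i i.2) hne
  have hex : ∀ i ∈ S, ∃ Γ : (V × List E) →₀ K, (∀ w, Γ w ≠ 0 → w ∈ SQ s r F i) ∧
      D.ev Γ = y * (t * D.pp F i) := by
    intro i hi
    have := D.right_mem (F := F) i (hy1 ⟨i, hi⟩)
    rw [mul_assoc, mul_assoc, D.pp_right (hS i hi)] at this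
    exact D.mem_Gs.1 this
  choose! Γ hΓ1 hΓ2 using hex
  let P : Finset ((_ : Bool × V × List E) × (V × List E)) := S.sigma (fun i => (Γ i).support)
  have hP : ∀ p, p ∈ P ↔ p.1 ∈ S ∧ Γ p.1 p.2 ≠ 0 := by
    intro p; simp [P]
  let Θ : (V × List E) →₀ K := ∑ p ∈ P, Γ p.1 p.2 • app p.2.2 (g p.1)
  have hΘev : D.ev Θ = 0 := by
    have e1 : D.ev Θ = ∑ i ∈ S, ∑ w ∈ (Γ i).support, Γ i w • (D.gh w.2 * D.ev (g i)) := by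
      rw [map_sum, Finset.sum_sigma]
      simp only [map_smul, ev_app]
    have e2 : ∀ i ∈ S, ∑ w ∈ (Γ i).support, Γ i w • (D.gh w.2 * D.ev (g i)) =
        y * (t * (D.pp F i * D.ev (g i))) := by
      intro i hi
      rw [← mul_assoc t, ← mul_assoc y, ← hΓ2 i hi, D.ev_apply (Γ i), Finset.sum_mul]
      refine Finset.sum_congr rfl fun w hw => ?_
      have hw' := hΓ1 i hi w (by simpa using hw)
      rw [smul_mul_assoc, mo, hw'.2.1, mul_assoc, D.ev_vx (hg i (hS i hi)).1]
    rw [e1, Finset.sum_congr rfl e2, ← Finset.mul_sum, h0, mul_zero]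
  have hΘ : Θ = 0 := by
    refine D.indep Θ ?_ hΘev
    intro w hw
    by_contra hcon
    apply hw
    rw [Finset.sum_apply']
    refine Finset.sum_eq_zero fun p hp => ?_
    rw [Finsupp.smul_apply]
    by_cases hz : app p.2.2 (g p.1) w = 0
    · rw [hz, smul_zero]
    · exfalso
      obtain ⟨l, h1, h2⟩ := app_ne_zero hz
      obtain ⟨hpS, hpn⟩ := (hP p).1 hp
      obtain ⟨h3, h4, -⟩ := (hg _ (hS _ hpS)).1 _ h2
      obtain ⟨h5, h6, -⟩ := hΓ1 _ hpS _ hpn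
      apply hcon
      rw [h1]
      refine (Vd_append s r _ _ _).2 ⟨h3, ?_⟩
      simp only at h4
      rw [h4, ← h6]; exact h5
  have hPne : P.Nonempty := by
    have : Γ i₀ ≠ 0 := by
      intro h
      have := hΓ2 i₀ hi₀
      rw [h, map_zero] at this
      exact hy2 this.symm
    obtain ⟨w, hw⟩ := Finsupp.support_nonempty_iff.2 this
    exact ⟨⟨i₀, w⟩, (hP _).2 ⟨hi₀, by simpa using hw⟩⟩
  obtain ⟨p, hp, hmax⟩ := exists_max_rel lt P hPne (fun p => (p.1.2.1, p.1.2.2 ++ p.2.2))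
  obtain ⟨hpS, hpn⟩ := (hP p).1 hp
  apply hpn
  have hval : Θ (p.1.2.1, p.1.2.2 ++ p.2.2) = Γ p.1 p.2 := by
    rw [Finset.sum_apply', Finset.sum_eq_single p]
    · rw [Finsupp.smul_apply, app_apply]
      have : g p.1 (p.1.2.1, p.1.2.2) = 1 := (hg _ (hS _ hpS)).2.1.1
      rw [this, smul_eq_mul, mul_one]
    · intro p' hp' hpp
      obtain ⟨hpS', hpn'⟩ := (hP p').1 hp'
      rw [Finsupp.smul_apply]
      by_cases hz : app p'.2.2 (g p'.1) (p.1.2.1, p.1.2.2 ++ p.2.2) = 0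
      · rw [hz, smul_zero]
      · exfalso
        have hl := (app_lead hlt (u := p'.1.2.1) (l := p'.1.2.2)
          (hg _ (hS _ hpS')).2.1 p'.2.2).2 _ hz
        have heq : (p.1.2.1, p.1.2.2 ++ p.2.2) = (p'.1.2.1, p'.1.2.2 ++ p'.2.2) := by
          rcases hl with h | h
          · exact h
          · rcases hmax p' hp' with h' | h'
            · exact h'.symm
            · exact absurd h' (asymm h)
        obtain ⟨h1, h2⟩ := D.inj_words hlt (hS _ hpS) (hS _ hpS') (hΓ1 _ hpS _ hpn)
          (hΓ1 _ hpS' _ hpn') heq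
        exact hpp (Sigma.ext h1.symm (heq_of_eq h2.symm))
    · exact fun h => absurd hp h
  rw [← hval, hΘ]; rfl

end

include D in
theorem bezout (a b : L) : ∃ z e : L,
    Submodule.span L {a} ⊔ Submodule.span L {b} = Submodule.span L {z} ∧ e * z = z ∧
      ∀ t, t * z = 0 → t * e = 0 := by
  obtain ⟨lt, hwo, hlt⟩ := exists_word_order V E
  obtain ⟨F, n, hF⟩ := D.exists_T_fam ({a, b} : Finset L) id
  set I : Submodule L L := Submodule.span L {a} ⊔ Submodule.span L {b} with hI
  have haI : a ∈ I := Submodule.mem_sup_left (Submodule.mem_span_singleton_self a)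
  have hbI : b ∈ I := Submodule.mem_sup_right (Submodule.mem_span_singleton_self b)
  have hex : ∀ i, D.Good lt I F i → ∃ Γ, D.IsN lt I F i.1 i.2 Γ := fun i hi => hi.1
  choose! g hg using hex
  have ha := D.generate' hlt g hg (hF a (by simp)) haI
  have hb := D.generate' hlt g hg (hF b (by simp)) hbI
  obtain ⟨Sa, hSa, ha'⟩ := Submodule.mem_span_finite_of_mem_span ha
  obtain ⟨Sb, hSb, hb'⟩ := Submodule.mem_span_finite_of_mem_span hb
  obtain ⟨S, hS, hSim⟩ : ∃ S : Finset (Bool × V × List E), (∀ i ∈ S, D.Good lt I F i) ∧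
      ∀ x ∈ Sa ∪ Sb, ∃ i ∈ S, D.th F i.1 * D.ev (g i) = x := by
    have : ((Sa ∪ Sb : Finset L) : Set L) ⊆
        (fun i => D.th F i.1 * D.ev (g i)) '' {i | D.Good lt I F i} := by
      rw [Finset.coe_union]; exact Set.union_subset hSa hSb
    obtain ⟨S, h1, h2⟩ := Finset.subset_set_image_iff.1 this
    refine ⟨S, fun i hi => h1 hi, fun x hx => ?_⟩
    rw [← h2] at hx
    simpa using hx
  let z : L := ∑ i ∈ S, D.pp F i * D.ev (g i)
  have hqz : ∀ i ∈ S, D.qq F i * z = D.th F i.1 * D.ev (g i) := by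
    intro i hi
    rw [Finset.mul_sum, Finset.sum_eq_single i]
    · exact D.qq_pp (hS i hi) (hg i (hS i hi))
    · intro j hj hji
      rw [← mul_assoc, D.orth hlt (hS i hi) (hS j hj) (Ne.symm hji), zero_mul]
    · exact fun h => absurd hi h
  have hpth : ∀ i, D.pp F i * D.ev (g i) = D.pp F i * (D.th F i.1 * D.ev (g i)) := by
    intro i
    rw [← mul_assoc, pp, mul_assoc _ (D.th F i.1) (D.th F i.1), D.th_idem]
  refine ⟨z, ∑ i ∈ S, D.pp F i * D.qq F i, ?_, ?_, ?_⟩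
  · apply le_antisymm
    · have hle : ∀ S' : Finset L, S' ⊆ Sa ∪ Sb →
          Submodule.span L (S' : Set L) ≤ Submodule.span L {z} := by
        intro S' hS'
        rw [Submodule.span_le]
        intro x hx
        obtain ⟨i, hi, rfl⟩ := hSim x (hS' hx)
        rw [← hqz i hi]
        exact Submodule.smul_mem _ _ (Submodule.mem_span_singleton_self z)
      refine sup_le ?_ ?_
      · rw [Submodule.span_singleton_le_iff_mem]
        exact hle Sa Finset.subset_union_left ha'
      · rw [Submodule.span_singleton_le_iff_mem]
        exact hle Sb Finset.subset_union_right hb'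
    · rw [Submodule.span_singleton_le_iff_mem]
      refine Submodule.sum_mem _ fun i hi => ?_
      rw [hpth]
      exact I.smul_mem _ (hg i (hS i hi)).2.2
  · rw [Finset.sum_mul]
    refine Finset.sum_congr rfl fun i hi => ?_
    rw [mul_assoc, hqz i hi, ← hpth]
  · intro t ht
    rw [Finset.mul_sum] at ht
    have := D.independent hlt g hg S hS t ht
    rw [Finset.mul_sum]
    refine Finset.sum_eq_zero fun i hi => ?_
    rw [← mul_assoc, this i hi, zero_mul]

include D in
theorem main (a b : L) :
    (∃ c : L, Submodule.span L {a} ⊔ Submodule.span L {b} = Submodule.span L {c}) ∧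
    (∃ d : L, Submodule.span L {a} ⊓ Submodule.span L {b} = Submodule.span L {d}) := by
  obtain ⟨z, e, hz, hez, hann⟩ := D.bezout a b
  refine ⟨⟨z, hz⟩, ?_⟩
  have haz : a ∈ Submodule.span L {z} := hz ▸
    Submodule.mem_sup_left (Submodule.mem_span_singleton_self a)
  have hbz : b ∈ Submodule.span L {z} := hz ▸
    Submodule.mem_sup_right (Submodule.mem_span_singleton_self b)
  have hzab : z ∈ Submodule.span L {a} ⊔ Submodule.span L {b} := hz ▸
    Submodule.mem_span_singleton_self z
  obtain ⟨α, hα⟩ := Submodule.mem_span_singleton.1 haz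
  obtain ⟨β, hβ⟩ := Submodule.mem_span_singleton.1 hbz
  obtain ⟨x1, hx1, x2, hx2, hxz⟩ := Submodule.mem_sup.1 hzab
  obtain ⟨γ, hγ⟩ := Submodule.mem_span_singleton.1 hx1
  obtain ⟨δ, hδ⟩ := Submodule.mem_span_singleton.1 hx2
  simp only [smul_eq_mul] at hα hβ hγ hδ
  rw [← hγ, ← hδ] at hxz
  have hγa : γ * a = z - δ * b := by rw [← hxz]; abel
  obtain ⟨d, _, hd, -, -⟩ := D.bezout ((1 - α * e * γ) * a) (β * e * γ * a)
  refine ⟨d, ?_⟩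
  rw [← hd]
  apply le_antisymm
  · rintro x ⟨h1, h2⟩
    obtain ⟨p, rfl⟩ := Submodule.mem_span_singleton.1 h1
    obtain ⟨q, hq⟩ := Submodule.mem_span_singleton.1 h2
    simp only [smul_eq_mul] at hq ⊢
    have h0 : (p * α - q * β) * z = 0 := by
      rw [sub_mul, mul_assoc, mul_assoc, hα, hβ, hq, sub_self]
    have h3 := hann _ h0
    have h4 : p * a = p * ((1 - α * e * γ) * a) + q * (β * e * γ * a) := by
      have : p * α * e = q * β * e := by
        rw [← sub_eq_zero, ← sub_mul]; exact h3
      have h5 : q * (β * e * γ * a) = p * α * e * (γ * a) := by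
        rw [this]; simp only [mul_assoc]
      rw [h5]; noncomm_ring
    rw [h4]
    exact add_mem
      (Submodule.mem_sup_left (Submodule.smul_mem _ _ (Submodule.mem_span_singleton_self _)))
      (Submodule.mem_sup_right (Submodule.smul_mem _ _ (Submodule.mem_span_singleton_self _)))
  · refine sup_le ?_ ?_
    · rw [Submodule.span_singleton_le_iff_mem]
      refine ⟨Submodule.smul_mem _ _ (Submodule.mem_span_singleton_self _), ?_⟩
      have : (1 - α * e * γ) * a = (α * e * δ) * b := by
        have h6 : α * e * (γ * a) = a - α * e * δ * b := by
          rw [hγa, mul_sub, mul_assoc α e z, hez, hα]; simp only [mul_assoc]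
        rw [sub_mul, one_mul, mul_assoc (α * e), h6]; abel
      rw [this]
      exact Submodule.smul_mem _ _ (Submodule.mem_span_singleton_self _)
    · rw [Submodule.span_singleton_le_iff_mem]
      refine ⟨Submodule.smul_mem _ _ (Submodule.mem_span_singleton_self _), ?_⟩
      have : β * e * γ * a = (1 - β * e * δ) * b := by
        rw [mul_assoc (β * e), hγa, mul_sub, mul_assoc β e z, hez, hβ, sub_mul, one_mul]
        simp only [mul_assoc]
      rw [this]
      exact Submodule.smul_mem _ _ (Submodule.mem_span_singleton_self _)

end LDat
end LPAProof
namespace LPAProof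
open Classical

theorem exists_pairing {V E : Type} (s : E → V) :
    ∃ (c : E → ℕ ⊕ E → ℕ ⊕ E) (p1 : V → ℕ ⊕ E → Option E) (p2 : V → ℕ ⊕ E → ℕ ⊕ E),
      (∀ e k, p1 (s e) (c e k) = some e) ∧ (∀ e k, p2 (s e) (c e k) = k) ∧
      (∀ e k, ∃ f, s f = s e ∧ p1 (s e) k = some f) ∧
      (∀ f v k, p1 v k = some f → s f = v ∧ c f (p2 v k) = k) := by
  have key : ∀ v : V, Nonempty {e // s e = v} →
      Nonempty (({e // s e = v} × (ℕ ⊕ E)) ≃ (ℕ ⊕ E)) := by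
    intro v hv
    rw [← Cardinal.eq, Cardinal.mk_prod, Cardinal.lift_id, Cardinal.lift_id]
    refine Cardinal.mul_eq_right (Cardinal.aleph0_le_mk _) ?_ (Cardinal.mk_ne_zero _)
    exact Cardinal.mk_le_of_injective (f := fun e => Sum.inr e.1)
      (fun a b h => Subtype.ext (Sum.inr.inj h))
  let φ := fun v (hv : Nonempty {e // s e = v}) => Classical.choice (key v hv)
  have hne : ∀ e, Nonempty {f // s f = s e} := fun e => ⟨⟨e, rfl⟩⟩
  refine ⟨fun e k => φ (s e) (hne e) (⟨e, rfl⟩, k),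
    fun v k => if h : Nonempty {e // s e = v} then some ((φ v h).symm k).1.1 else none,
    fun v k => if h : Nonempty {e // s e = v} then ((φ v h).symm k).2 else k, ?_, ?_, ?_, ?_⟩
  · intro e k
    simp [hne e]
  · intro e k
    simp [hne e]
  · intro e k
    exact ⟨_, ((φ (s e) (hne e)).symm k).1.2, by simp only [dif_pos (hne e)]⟩
  · intro f v k h
    by_cases hv : Nonempty {e // s e = v}
    · simp only [dif_pos hv, Option.some.injEq] at h ⊢
      have h1 := ((φ v hv).symm k).1.2
      rw [h] at h1
      refine ⟨h1, ?_⟩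
      subst h1
      have h3 : ((⟨f, rfl⟩ : {e // s e = s f}), ((φ (s f) hv).symm k).2) = (φ (s f) hv).symm k := by
        refine Prod.ext (Subtype.ext h.symm) rfl
      rw [h3, Equiv.apply_symm_apply]
    · simp only [dif_neg hv] at h
      exact absurd h (by simp)

section rep
variable (K : Type) {V E κ : Type} [Field K] (s r : E → V)
  (c : E → κ → κ) (p1 : V → κ → Option E) (p2 : V → κ → κ)

/-- vertex action -/
noncomputable def aV (u : V) : Module.End K (V × κ × ℤ → K) where
  toFun f := fun x => if x.1 = u then f x else 0
  map_add' f g := by funext x; by_cases h : x.1 = u <;> simp [h]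
  map_smul' a f := by funext x; by_cases h : x.1 = u <;> simp [h]

/-- ghost action -/
noncomputable def aG (e : E) : Module.End K (V × κ × ℤ → K) where
  toFun f := fun x => if x.1 = r e then f (s e, c e x.2.1, x.2.2 + 1) else 0
  map_add' f g := by funext x; by_cases h : x.1 = r e <;> simp [h]
  map_smul' a f := by funext x; by_cases h : x.1 = r e <;> simp [h]

/-- edge action -/
noncomputable def aE (e : E) : Module.End K (V × κ × ℤ → K) where
  toFun f := fun x => if x.1 = s e ∧ p1 x.1 x.2.1 = some e then
    f (r e, p2 x.1 x.2.1, x.2.2 - 1) else 0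
  map_add' f g := by
    funext x
    by_cases h : x.1 = s e ∧ p1 x.1 x.2.1 = some e
    · simp only [if_pos h, Pi.add_apply, Pi.smul_apply, RingHom.id_apply]
    · simp only [if_neg h, Pi.add_apply, Pi.smul_apply, RingHom.id_apply, add_zero, smul_zero]
  map_smul' a f := by
    funext x
    by_cases h : x.1 = s e ∧ p1 x.1 x.2.1 = some e
    · simp only [if_pos h, Pi.add_apply, Pi.smul_apply, RingHom.id_apply]
    · simp only [if_neg h, Pi.add_apply, Pi.smul_apply, RingHom.id_apply, add_zero, smul_zero]

theorem aV_apply (u : V) (f : V × κ × ℤ → K) (x) :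
    aV K u f x = if x.1 = u then f x else 0 := rfl
theorem aG_apply (e : E) (f : V × κ × ℤ → K) (x) :
    aG K s r c e f x = if x.1 = r e then f (s e, c e x.2.1, x.2.2 + 1) else 0 := rfl
theorem aE_apply (e : E) (f : V × κ × ℤ → K) (x) :
    aE K s r p1 p2 e f x = if x.1 = s e ∧ p1 x.1 x.2.1 = some e then
      f (r e, p2 x.1 x.2.1, x.2.2 - 1) else 0 := rfl

/-- generator action -/
noncomputable def aGen : LPAGen V E → Module.End K (V × κ × ℤ → K)
  | .vertex v => aV K v
  | .edge e => aE K s r p1 p2 e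
  | .ghost e => aG K s r c e

theorem rep_exists [Fintype V]
    (h1 : ∀ e k, p1 (s e) (c e k) = some e) (h2 : ∀ e k, p2 (s e) (c e k) = k)
    (h3 : ∀ e k, ∃ f, s f = s e ∧ p1 (s e) k = some f)
    (h4 : ∀ f v k, p1 v k = some f → s f = v ∧ c f (p2 v k) = k) :
    ∃ ρ : LeavittPathAlgebra K V E s r →ₐ[K] Module.End K (V × κ × ℤ → K),
      ∀ x, ρ (RingQuot.mkAlgHom K (LPARel K V E s r) (FreeAlgebra.ι K x)) =
        aGen K s r c p1 p2 x := by
  refine ⟨RingQuot.liftAlgHom K ⟨FreeAlgebra.lift K (aGen K s r c p1 p2), ?_⟩, ?_⟩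
  · intro x y h
    induction h with
    | vertex_orth v w h =>
      simp only [map_mul, map_zero, FreeAlgebra.lift_ι_apply, aGen]
      ext f x
      simp only [Module.End.mul_apply, aV_apply, LinearMap.zero_apply, Pi.zero_apply]
      split_ifs with h5 h6
      · exact absurd (h5.symm.trans h6) h
      · rfl
      · rfl
    | vertex_idem v =>
      simp only [map_mul, FreeAlgebra.lift_ι_apply, aGen]
      ext f x
      simp only [Module.End.mul_apply, aV_apply]
      split_ifs <;> rfl
    | edge_src e =>
      simp only [map_mul, FreeAlgebra.lift_ι_apply, aGen]
      ext f x
      simp only [Module.End.mul_apply, aV_apply, aE_apply]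
      split_ifs with h5 h6 h7 <;> first | rfl | (exfalso; tauto)
    | edge_rng e =>
      simp only [map_mul, FreeAlgebra.lift_ι_apply, aGen]
      ext f x
      simp only [Module.End.mul_apply, aV_apply, aE_apply, if_true]
    | ghost_rng e =>
      simp only [map_mul, FreeAlgebra.lift_ι_apply, aGen]
      ext f x
      simp only [Module.End.mul_apply, aV_apply, aG_apply]
      split_ifs <;> rfl
    | ghost_src e =>
      simp only [map_mul, FreeAlgebra.lift_ι_apply, aGen]
      ext f x
      simp only [Module.End.mul_apply, aV_apply, aG_apply, if_true]
    | ck1_distinct e f h =>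
      simp only [map_mul, map_zero, FreeAlgebra.lift_ι_apply, aGen]
      ext g x
      simp only [Module.End.mul_apply, aE_apply, aG_apply, LinearMap.zero_apply, Pi.zero_apply, h1]
      split_ifs with h5 h6
      · exact absurd (Option.some.inj h6.2) h
      · rfl
      · rfl
    | ck1_same e =>
      simp only [map_mul, FreeAlgebra.lift_ι_apply, aGen]
      ext g x
      obtain ⟨v, k, n⟩ := x
      simp only [Module.End.mul_apply, aE_apply, aG_apply, aV_apply, h1, h2, and_self, if_true,
        add_sub_cancel_right]
      split_ifs with h5
      · rw [h5]
      · rfl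
    | ck2 v h hne =>
      simp only [map_mul, map_sum, FreeAlgebra.lift_ι_apply, aGen]
      ext g x
      obtain ⟨u, k, n⟩ := x
      rw [LinearMap.sum_apply, Finset.sum_apply]
      simp only [Module.End.mul_apply, aE_apply, aG_apply, aV_apply, if_true]
      split_ifs with h5
      · subst h5
        obtain ⟨e, he⟩ := hne
        obtain ⟨f, hf, hp⟩ := h3 e k
        rw [he] at hf hp
        obtain ⟨h6, h7⟩ := h4 _ _ _ hp
        rw [Finset.sum_eq_single f]
        · rw [if_pos ⟨h6.symm, hp⟩, h7, h6, sub_add_cancel]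
        · intro b _ hb
          rw [if_neg]
          rintro ⟨-, h8⟩
          rw [hp] at h8
          exact hb (Option.some.inj h8).symm
        · intro h8
          exact absurd (by simpa using hf) h8
      · symm
        refine Finset.sum_eq_zero fun e he => ?_
        rw [if_neg]
        rintro ⟨h8, -⟩
        have : s e = v := by simpa using he
        exact h5 (h8.trans this)
    | unit =>
      simp only [map_one, map_sum, FreeAlgebra.lift_ι_apply, aGen]
      ext g x
      rw [LinearMap.sum_apply, Finset.sum_apply]
      simp [aV_apply]
  · intro x
    rw [RingQuot.liftAlgHom_mkAlgHom_apply, FreeAlgebra.lift_ι_apply]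

/-- iterated encoding -/
def cc : List E → κ → κ
  | [], k => k
  | e :: l, k => c e (cc l k)

theorem cc_inj (h1 : ∀ e k, p1 (s e) (c e k) = some e) (h2 : ∀ e k, p2 (s e) (c e k) = k)
    (u : V) (l l' : List E) (k : κ) (hl : Vd s r u l) (hl' : Vd s r u l')
    (hlen : l.length = l'.length) (h : cc c l k = cc c l' k) : l = l' := by
  induction l generalizing u l' with
  | nil => exact (List.length_eq_zero_iff.1 hlen.symm).symm
  | cons e l ih =>
    cases l' with
    | nil => simp at hlen
    | cons f l' =>
      simp only [cc] at h
      have h5 := h1 e (cc c l k)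
      rw [h, hl.1, ← hl'.1, h1 f] at h5
      obtain rfl := Option.some.inj h5
      have h6 := h2 f (cc c l k)
      rw [h, h2] at h6
      rw [ih (r f) l' hl.2 hl'.2 (by simpa using hlen) h6.symm]

theorem ghp_apply (u : V) (l : List E) (hl : Vd s r u l) (f : V × κ × ℤ → K) (v k n) :
    (ghp (aG K s r c) l * aV K u : Module.End K (V × κ × ℤ → K)) f (v, k, n) =
      if v = tgt r u l then f (u, cc c l k, n + l.length) else 0 := by
  induction l generalizing u f with
  | nil =>
    simp only [ghp, one_mul, aV_apply, tgt, cc, List.length_nil, Nat.cast_zero, add_zero]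
    split_ifs with h
    · rw [h]
    · rfl
  | cons e l ih =>
    obtain ⟨rfl, h⟩ := hl
    have h5 : (ghp (aG K s r c) (e :: l) * aV K (s e) : Module.End K (V × κ × ℤ → K)) f =
        (ghp (aG K s r c) l * aV K (r e) : Module.End K (V × κ × ℤ → K)) (aG K s r c e f) := by
      simp only [ghp, Module.End.mul_apply]
      congr 1
      funext x
      simp only [aV_apply, aG_apply, if_true]
      split_ifs <;> rfl
    rw [h5, ih (r e) h]
    simp only [tgt, aG_apply, if_true, cc, List.length_cons, Nat.cast_add, Nat.cast_one, add_assoc]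

end rep

section inst
variable (K V E : Type) [Field K] [Fintype V] (s r : E → V)

/-- image of a generator -/
noncomputable def gen (x : LPAGen V E) : LeavittPathAlgebra K V E s r :=
  RingQuot.mkAlgHom K (LPARel K V E s r) (FreeAlgebra.ι K x)

theorem gen_indep (Γ : (V × List E) →₀ K) (hΓ : ∀ w, Γ w ≠ 0 → Vd s r w.1 w.2)
    (h0 : evl K (fun v => gen K V E s r (.vertex v)) (fun e => gen K V E s r (.ghost e)) Γ = 0) :
    Γ = 0 := by
  obtain ⟨c, p1, p2, h1, h2, h3, h4⟩ := exists_pairing s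
  obtain ⟨ρ, hρ⟩ := rep_exists K s r c p1 p2 h1 h2 h3 h4
  by_contra hne
  obtain ⟨⟨u, l⟩, hw⟩ := Finsupp.ne_iff.1 hne
  rw [Finsupp.zero_apply] at hw
  have hVd := hΓ _ hw
  have hgh : ∀ l, ρ (ghp (fun e => gen K V E s r (.ghost e)) l) = ghp (aG K s r c) l := by
    intro l
    induction l with
    | nil => simp [ghp]
    | cons e l ih =>
      simp only [ghp, map_mul, ih]
      rw [gen, hρ]; rfl
  have hmono : ∀ w : V × List E, ρ (mono (fun v => gen K V E s r (.vertex v))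
      (fun e => gen K V E s r (.ghost e)) w) = ghp (aG K s r c) w.2 * aV K w.1 := by
    intro w
    rw [mono, map_mul, hgh, gen, hρ]; rfl
  have h5 := congrArg ρ h0
  rw [evl, Finsupp.linearCombination_apply, Finsupp.sum, map_sum, map_zero] at h5
  simp only [map_smul, hmono] at h5
  let k : ℕ ⊕ E := Sum.inl 0
  let f : V × (ℕ ⊕ E) × ℤ → K := fun x => if x = (u, cc c l k, (l.length : ℤ)) then 1 else 0
  have h6 := congrFun (LinearMap.congr_fun h5 f) (tgt r u l, k, 0)
  rw [LinearMap.sum_apply, Finset.sum_apply, Finset.sum_eq_single (u, l)] at h6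
  · simp only [LinearMap.smul_apply, Pi.smul_apply, LinearMap.zero_apply, Pi.zero_apply] at h6
    rw [ghp_apply K s r c u l hVd] at h6
    simp [f] at h6
    exact hw h6
  · rintro ⟨u', l'⟩ hmem hb
    have hVd' := hΓ _ (by simpa using hmem)
    simp only [LinearMap.smul_apply, Pi.smul_apply]
    rw [ghp_apply K s r c u' l' hVd']
    split_ifs with h7
    · simp only [f]
      rw [if_neg, smul_zero]
      intro h8
      simp only [Prod.mk.injEq, zero_add, Nat.cast_inj] at h8
      obtain ⟨rfl, h9, h10⟩ := h8
      exact hb (by rw [cc_inj s r c p1 p2 h1 h2 u' l' l k hVd' hVd h10 h9])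
    · rw [smul_zero]
  · intro h7
    exact absurd (by simpa using hw) h7

/-- the Leavitt path algebra data -/
noncomputable def theDat : LDat K V E (LeavittPathAlgebra K V E s r) s r where
  vx v := gen K V E s r (.vertex v)
  eg e := gen K V E s r (.edge e)
  gs e := gen K V E s r (.ghost e)
  vx_orth v w h := by
    simpa only [gen, map_mul, map_zero] using
      RingQuot.mkAlgHom_rel K (LPARel.vertex_orth (s := s) (r := r) v w h)
  vx_idem v := by
    simpa only [gen, map_mul] using
      RingQuot.mkAlgHom_rel K (LPARel.vertex_idem (s := s) (r := r) v)
  src_eg e := by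
    simpa only [gen, map_mul] using
      RingQuot.mkAlgHom_rel K (LPARel.edge_src (s := s) (r := r) e)
  eg_rng e := by
    simpa only [gen, map_mul] using
      RingQuot.mkAlgHom_rel K (LPARel.edge_rng (s := s) (r := r) e)
  rng_gs e := by
    simpa only [gen, map_mul] using
      RingQuot.mkAlgHom_rel K (LPARel.ghost_rng (s := s) (r := r) e)
  gs_src e := by
    simpa only [gen, map_mul] using
      RingQuot.mkAlgHom_rel K (LPARel.ghost_src (s := s) (r := r) e)
  ck1_ne e f h := by
    simpa only [gen, map_mul, map_zero] using
      RingQuot.mkAlgHom_rel K (LPARel.ck1_distinct (s := s) (r := r) e f h)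
  ck1 e := by
    simpa only [gen, map_mul] using
      RingQuot.mkAlgHom_rel K (LPARel.ck1_same (s := s) (r := r) e)
  ck2 v F hF hne := by
    have hset : {e : E | s e = v} = (F : Set E) := by
      ext e; simp [hF]
    have hfin : {e : E | s e = v}.Finite := by rw [hset]; exact F.finite_toSet
    have hFeq : hfin.toFinset = F := by ext e; simp [hF]
    have := RingQuot.mkAlgHom_rel K (LPARel.ck2 (K := K) (s := s) (r := r) v hfin
      (by rw [hset]; exact hne))
    rw [hFeq] at this
    simpa only [gen, map_mul, map_sum] using this
  one_eq := by
    simpa only [gen, map_one, map_sum] using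
      RingQuot.mkAlgHom_rel K (LPARel.unit (K := K) (s := s) (r := r))
  ind U h1 hv he hg x := by
    obtain ⟨a, rfl⟩ := RingQuot.mkAlgHom_surjective K (LPARel K V E s r) x
    have key : ∀ y ∈ U, RingQuot.mkAlgHom K (LPARel K V E s r) a * y ∈ U := by
      induction a using FreeAlgebra.induction with
      | grade0 t =>
        intro y hy
        rw [AlgHom.commutes, ← Algebra.smul_def]
        exact U.smul_mem _ hy
      | grade1 g =>
        intro y hy
        cases g with
        | vertex v => exact hv v y hy
        | edge e => exact he e y hy
        | ghost e => exact hg e y hy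
      | mul a b iha ihb =>
        intro y hy
        rw [map_mul, mul_assoc]
        exact iha _ (ihb _ hy)
      | add a b iha ihb =>
        intro y hy
        rw [map_add, add_mul]
        exact U.add_mem (iha _ hy) (ihb _ hy)
    simpa using key 1 h1
  indep Γ h1 h2 := gen_indep K V E s r Γ h1 h2

end inst
end LPAProof

/-- For a directed graph `E` with finitely many vertices and a field
`K`, both the sum and the intersection of any two principal left ideals `L a`, `L b` of
the Leavitt path algebra `L = L_K(E)` are again principal left ideals; hence the
principal left ideals of `L` form a sublattice of the lattice of left ideals of `L`. -/
theorem lpa_principal_sublattice (K V E : Type) [Field K] [Fintype V] (s r : E → V) :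
    ∀ a b : LeavittPathAlgebra K V E s r,
      (∃ c : LeavittPathAlgebra K V E s r,
        Submodule.span (LeavittPathAlgebra K V E s r) {a} ⊔
          Submodule.span (LeavittPathAlgebra K V E s r) {b} =
          Submodule.span (LeavittPathAlgebra K V E s r) {c}) ∧
      (∃ d : LeavittPathAlgebra K V E s r,
        Submodule.span (LeavittPathAlgebra K V E s r) {a} ⊓
          Submodule.span (LeavittPathAlgebra K V E s r) {b} =
          Submodule.span (LeavittPathAlgebra K V E s r) {d}) := by
  intro a b
  exact LPAProof.LDat.main (LPAProof.theDat K V E s r) a b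
end
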